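/- Let g ≥ 0, n ≥ 1, a, b ∈ ℤ, and let d_1,…,d_n ≥ 1 be integers with Σ_{j=1}^n d_j = g+n. Then [L_g^{a,b}(y,x_1,…,x_n)]_{y^{2g−4+a+b} Π_{j=1}^n x_j^{d_j}} = (−1)^b (2g−3+n+a+b)!/(4^g (2g−3+a+b)! Π_{j=1}^n (2d_j−1)!!), where the quotient of factorials (2g−3+n+a+b)!/(2g−3+a+b)! is to be read as the product Π_{i=1}^{n} (2g−3+a+b+i). -/

import Mathlib

open MvPolynomial Finset

noncomputable section

/-- The polynomial ring `ℚ[x_1,…,x_n]`. -/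
abbrev R (n : ℕ) : Type := MvPolynomial (Fin n) ℚ

/-- The field of rational functions `ℚ(x_1,…,x_n)`. -/
abbrev K (n : ℕ) : Type := FractionRing (R n)

/-- `x_1 + ⋯ + x_n` as an element of `K n`. -/
def SX (n : ℕ) : K n := algebraMap (R n) (K n) (∑ j, X j)

/-- `x_1^3 + ⋯ + x_n^3` as an element of `K n`. -/
def SX3 (n : ℕ) : K n := algebraMap (R n) (K n) (∑ j, (X j)^3)

/-- `Δ(x_1,…,x_n) = ((Σ x_j)^3 − Σ x_j^3)/3`. -/
def Dlt (n : ℕ) : K n := ((SX n)^3 - SX3 n) / 3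

/-- The ring homomorphism `ℚ[x_1,…,x_{|I|}] → ℚ(x_1,…,x_n)` substituting the variables
of the subset `I` (in increasing order). -/
def embRH {n : ℕ} (I : Finset (Fin n)) : R I.card →+* K n :=
  (algebraMap (R n) (K n)).comp
    (MvPolynomial.rename (fun i : Fin I.card => ((I.orderIsoOfFin rfl) i : Fin n))).toRingHom

lemma embRH_inj {n : ℕ} (I : Finset (Fin n)) : Function.Injective (embRH I) := by
  have h1 : Function.Injective (fun i : Fin I.card => ((I.orderIsoOfFin rfl) i : Fin n)) := by
    intro i j hij
    exact (I.orderIsoOfFin rfl).injective (Subtype.val_injective hij)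
  have h2 := (IsFractionRing.injective (R n) (K n)).comp (MvPolynomial.rename_injective _ h1)
  simpa [embRH, RingHom.coe_comp] using h2

/-- The field embedding `ℚ(x_1,…,x_{|I|}) → ℚ(x_1,…,x_n)` substituting the variables
of the subset `I` (in increasing order).  Used for expressions like `G_{r'}(x_I)`. -/
def emb {n : ℕ} (I : Finset (Fin n)) : K I.card →+* K n :=
  IsFractionRing.lift (embRH_inj I)

/-- The normalized `n`-point functions `G_g(x_1,…,x_n)`, defined with a fuel parameter
(first argument) for structural recursion; for `fuel ≥ n` this computes the recursively
defined normalized `n`-point function:  `G_0(x) = x^{-2}`, `G_g(x) = 0` for `g ≥ 1`, and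
for `n ≥ 2`,
`G_g = Σ_{r+s=g} ((2r+n−3)!!/(4^s(2r+2s+n−1)!!)) P_r Δ^s` where
`P_r = (1/(2Σx_j)) Σ_{I⊔J={1..n}, I,J≠∅} (Σ_I x)²(Σ_J x)² Σ_{r'≤r} G_{r'}(x_I)G_{r−r'}(x_J)`. -/
def Gf : (fuel : ℕ) → (n : ℕ) → ℕ → K n
  | _, 0, _ => 0
  | _, 1, 0 => (algebraMap (R 1) (K 1) (X 0)) ^ (-2 : ℤ)
  | _, 1, _+1 => 0
  | 0, _+2, _ => 0
  | fuel+1, n+2, g =>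
      ∑ s ∈ Finset.range (g+1),
        (((Nat.doubleFactorial (2*(g-s)+(n+2)-3) : ℚ) /
          (4^s * (Nat.doubleFactorial (2*g+(n+2)-1) : ℚ))) : K (n+2)) *
        ((2 * SX (n+2))⁻¹ *
          ∑ I : Finset (Fin (n+2)),
            if I ≠ ∅ ∧ I ≠ univ then
              (algebraMap (R (n+2)) (K (n+2)) (∑ i ∈ I, X i))^2 *
              (algebraMap (R (n+2)) (K (n+2)) (∑ i ∈ Iᶜ, X i))^2 *
              ∑ r' ∈ Finset.range ((g-s)+1),
                emb I (Gf fuel I.card r') * emb Iᶜ (Gf fuel Iᶜ.card ((g-s) - r'))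
            else 0) *
        (Dlt (n+2))^s

/-- The normalized `n`-point function `G_g(x_1,…,x_n)` as an element of `ℚ(x_1,…,x_n)`. -/
def Gnpt (n g : ℕ) : K n := Gf n n g

/-- `P_r(x_1,…,x_n)`. -/
def Ppoly (n r : ℕ) : K n :=
  (2 * SX n)⁻¹ *
    ∑ I : Finset (Fin n),
      if I ≠ ∅ ∧ I ≠ univ then
        (algebraMap (R n) (K n) (∑ i ∈ I, X i))^2 *
        (algebraMap (R n) (K n) (∑ i ∈ Iᶜ, X i))^2 *
        ∑ r' ∈ Finset.range (r+1), emb I (Gnpt I.card r') * emb Iᶜ (Gnpt Iᶜ.card (r - r'))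
      else 0

/-- The `n`-point function `F_g(x_1,…,x_n) = Σ_{h+d=g} (1/d!)((Σx_j^3)/24)^d G_h(x_1,…,x_n)`. -/
def Fnpt (n g : ℕ) : K n :=
  ∑ d ∈ Finset.range (g+1),
    ((1 / (Nat.factorial d : ℚ)) : K n) * (SX3 n / 24)^d * Gnpt n (g-d)

open Classical in
/-- The coefficient of the monomial `Π x_j^{d_j}` of an element of `ℚ(x_1,…,x_n)` which is
a polynomial (junk value `0` otherwise). -/
def coeffK {n : ℕ} (f : K n) (d : Fin n → ℕ) : ℚ :=
  if h : ∃ p : R n, algebraMap (R n) (K n) p = f then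
    MvPolynomial.coeff (Finsupp.equivFunOnFinite.symm d) h.choose
  else 0

/-- The intersection index `⟨τ_{d_1} ⋯ τ_{d_n}⟩_g`, i.e. the coefficient of `Π x_j^{d_j}`
in `F_g(x_1,…,x_n)`.  For `(g,n) = (0,1), (0,2)` and nonnegative `d_j` the value is `0`
(the conventional values `⟨τ_{-2}⟩_0 = 1`, `⟨τ_k τ_{-1-k}⟩_0 = (-1)^k` have a negative index). -/
def bracket (g : ℕ) {n : ℕ} (d : Fin n → ℕ) : ℚ :=
  if g = 0 ∧ n ≤ 2 then 0 else coeffK (Fnpt n g) d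

/-- `⟨τ_j Π_{i ∈ I} τ_{d_i}⟩_g` for a subset `I ⊆ {1,…,n}`. -/
def bracketI (g : ℕ) {n : ℕ} (j : ℕ) (I : Finset (Fin n)) (d : Fin n → ℕ) : ℚ :=
  bracket g (Fin.cons j (fun i : Fin I.card => d ((I.orderIsoOfFin rfl) i)))


/-! ### Laurent expansions in `y` (formal series in `ℚ[x_1,…,x_n][[y,y⁻¹]]` of bounded
`y`-degree, realized as Hahn/Laurent series in the variable `t = y⁻¹`, so that the
coefficient of `y^k` is the Hahn coefficient at `-k`). -/

/-- Laurent series in `t = y⁻¹` with coefficients in `ℚ[x_1,…,x_n]`. -/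
abbrev Lau (n : ℕ) : Type := LaurentSeries (R n)

/-- The generalized binomial coefficient `C(p,k) = p(p−1)⋯(p−k+1)/k!` for `p : ℤ`, `k : ℕ`. -/
def binomZ (p : ℤ) (k : ℕ) : ℚ := (∏ i ∈ Finset.range k, ((p : ℚ) - i)) / (Nat.factorial k)

/-- The expansion of `(y + c)^m = Σ_{k≥0} C(m,k) c^k y^{m−k}` as a Laurent series
in `t = y⁻¹` (for `m ≥ 0` this is the usual binomial expansion of the polynomial). -/
def yExpAdd {n : ℕ} (c : R n) (m : ℤ) : Lau n :=
  (HahnSeries.single (-m) (1 : R n)) *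
    HahnSeries.ofPowerSeries ℤ (R n)
      (PowerSeries.mk fun k => MvPolynomial.C (binomZ m k) * c^k)

/-- The expansion of `(±y + c)^m`, where the sign is `+` if `σ = true` and `−` otherwise;
it is computed as `(±1)^m (y ± c)^m`. -/
def LExp {n : ℕ} (σ : Bool) (c : R n) (m : ℤ) : Lau n :=
  (if σ then 1 else if Even m then 1 else -1 : Lau n) *
    yExpAdd ((if σ then 1 else -1 : R n) * c) m

open Classical in
/-- The polynomial representing an element of `ℚ(x_1,…,x_n)` lying in `ℚ[x_1,…,x_n]`
(junk value `0` otherwise). -/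
def polyOf {n : ℕ} (f : K n) : R n :=
  if h : ∃ p : R n, algebraMap (R n) (K n) p = f then h.choose else 0

/-- `±y` as a Laurent series in `t = y⁻¹`. -/
def yLau (n : ℕ) (σ : Bool) : Lau n :=
  (if σ then 1 else -1 : Lau n) * HahnSeries.single (-1 : ℤ) (1 : R n)

/-- The expansion of `F_g(±y, x_I)` as a Laurent series in `t = y⁻¹` with coefficients in
`ℚ[x_1,…,x_n]`: for `(g,|I|+1) = (0,1)` it is `(±y)^{-2} = y^{-2}`, for `(g,|I|+1) = (0,2)`
it is `1/(±y + x_i) = Σ_{k≥0} (−1)^k x_i^k (±y)^{−k−1}`, and otherwise it is obtained by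
substituting `±y` and the variables of `I` into the polynomial `F_g`. -/
def FExp {n : ℕ} (σ : Bool) (g : ℕ) (I : Finset (Fin n)) : Lau n :=
  if g = 0 ∧ I.card = 0 then HahnSeries.single (2 : ℤ) (1 : R n)
  else if g = 0 ∧ I.card = 1 then LExp σ (∑ i ∈ I, X i) (-1)
  else
    MvPolynomial.eval₂ ((HahnSeries.C).comp (algebraMap ℚ (R n)))
      (Fin.cons (yLau n σ)
        (fun i : Fin I.card => HahnSeries.C (X ((I.orderIsoOfFin rfl) i : Fin n))))
      (polyOf (Fnpt (I.card + 1) g))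

/-- `L_g^{a,b}(y, x_1,…,x_n) = Σ_{g'=0}^{g} Σ_{I⊔J={1,…,n}} (y+Σ_I x)^a (−y+Σ_J x)^b
F_{g'}(y,x_I) F_{g−g'}(−y,x_J)` as a Laurent series in `t = y⁻¹`. -/
def LL (g n : ℕ) (a b : ℤ) : Lau n :=
  ∑ gp ∈ Finset.range (g+1), ∑ I : Finset (Fin n),
    LExp true (∑ i ∈ I, X i) a * LExp false (∑ i ∈ Iᶜ, X i) b *
      FExp true gp I * FExp false (g - gp) Iᶜ

/-- The coefficient of `y^k Π_j x_j^{d_j}` in a Laurent series in `t = y⁻¹` with coefficients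
in `ℚ[x_1,…,x_n]`. -/
def coeffL {n : ℕ} (f : Lau n) (k : ℤ) (d : Fin n → ℕ) : ℚ :=
  MvPolynomial.coeff (Finsupp.equivFunOnFinite.symm d) (f.coeff (-k))

/-- The index of the variable `z_i` among the `a + b + n` variables `z, w, x`. -/
def zIdx (a b n : ℕ) (i : Fin a) : Fin (a+b+n) := ⟨i.1, by have := i.2; omega⟩

/-- The index of the variable `w_i` among the `a + b + n` variables `z, w, x`. -/
def wIdx (a b n : ℕ) (i : Fin b) : Fin (a+b+n) := ⟨a + i.1, by have := i.2; omega⟩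

/-- The index of the variable `x_i` among the `a + b + n` variables `z, w, x`. -/
def xIdx (a b n : ℕ) (i : Fin n) : Fin (a+b+n) := ⟨a + b + i.1, by have := i.2; omega⟩

/-- `L_g(y; z_1,…,z_a; w_1,…,w_b; x_1,…,x_n)
 = Σ_{g'=0}^{g} Σ_{I⊔J={1,…,n}} F_{g'}(y, z, x_I) F_{g−g'}(−y, w, x_J)`,
as a Laurent series in `t = y⁻¹` with coefficients in `ℚ[z,w,x]`. -/
def LLm (g n a b : ℕ) : Lau (a+b+n) :=
  ∑ gp ∈ Finset.range (g+1), ∑ I : Finset (Fin n),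
    FExp true gp ((univ.image (zIdx a b n)) ∪ I.image (xIdx a b n)) *
    FExp false (g - gp) ((univ.image (wIdx a b n)) ∪ Iᶜ.image (xIdx a b n))

/-- The exponent vector of the monomial `Π z_j^{r_j} Π w_j^{s_j} Π x_j^{d_j}`. -/
def expVec (a b n : ℕ) (r : Fin a → ℕ) (s : Fin b → ℕ) (d : Fin n → ℕ) :
    Fin (a+b+n) → ℕ :=
  fun v =>
    if h : v.1 < a then r ⟨v.1, h⟩
    else if h2 : v.1 < a + b then s ⟨v.1 - a, by omega⟩
    else d ⟨v.1 - (a+b), by have := v.2; omega⟩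

/-! ### Functions on finite sets under subset convolution -/

/-- Functions on finite subsets of `ι`, multiplied by subset convolution. -/
@[ext]
structure SetFun (ι B : Type*) where
  /-- The underlying function. -/
  toFun : Finset ι → B

namespace SetFun

section Basic

variable {ι B : Type*} [CommRing B]

instance : CoeFun (SetFun ι B) (fun _ => Finset ι → B) := ⟨toFun⟩

instance : Add (SetFun ι B) := ⟨fun f h => ⟨fun I => f I + h I⟩⟩

instance : Neg (SetFun ι B) := ⟨fun f => ⟨fun I => -f I⟩⟩

instance : Sub (SetFun ι B) := ⟨fun f h => ⟨fun I => f I - h I⟩⟩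

instance : Zero (SetFun ι B) := ⟨⟨fun _ => 0⟩⟩

@[simp] lemma add_apply (f h : SetFun ι B) (I : Finset ι) : (f + h) I = f I + h I := rfl

@[simp] lemma zero_apply (I : Finset ι) : (0 : SetFun ι B) I = 0 := rfl

@[simp] lemma neg_apply (f : SetFun ι B) (I : Finset ι) : (-f) I = -f I := rfl

@[simp] lemma sub_apply (f h : SetFun ι B) (I : Finset ι) : (f - h) I = f I - h I := rfl

end Basic

variable {ι B : Type*} [DecidableEq ι] [CommRing B]

instance : One (SetFun ι B) := ⟨⟨fun I => if I = ∅ then 1 else 0⟩⟩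

lemma one_apply (I : Finset ι) : (1 : SetFun ι B) I = if I = ∅ then 1 else 0 := rfl

instance : Mul (SetFun ι B) := ⟨fun f h => ⟨fun I => ∑ J ∈ I.powerset, f J * h (I \ J)⟩⟩

lemma mul_apply (f h : SetFun ι B) (I : Finset ι) :
    (f * h) I = ∑ J ∈ I.powerset, f J * h (I \ J) := rfl

/-- Exchanging a set and its complement in a sum over splittings. -/
lemma sum_powerset_sdiff_swap {M : Type*} [AddCommMonoid M] (I : Finset ι)
    (t : Finset ι → Finset ι → M) :
    ∑ J ∈ I.powerset, t J (I \ J) = ∑ J ∈ I.powerset, t (I \ J) J := by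
  refine sum_nbij' (fun J => I \ J) (fun J => I \ J) ?_ ?_ ?_ ?_ ?_
  · intro J _; simp
  · intro J _; simp
  · intro J hJ; exact Finset.sdiff_sdiff_eq_self (mem_powerset.1 hJ)
  · intro J hJ; exact Finset.sdiff_sdiff_eq_self (mem_powerset.1 hJ)
  · intro J hJ; simp only [Finset.sdiff_sdiff_eq_self (mem_powerset.1 hJ)]

/-- The two ways of summing over ordered splittings of a set into three parts. -/
lemma sum_powerset_powerset {M : Type*} [AddCommMonoid M] (I : Finset ι)
    (t : Finset ι → Finset ι → Finset ι → M) :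
    ∑ J ∈ I.powerset, ∑ K ∈ J.powerset, t K (J \ K) (I \ J)
      = ∑ K ∈ I.powerset, ∑ L ∈ (I \ K).powerset, t K L ((I \ K) \ L) := by
  rw [sum_sigma', sum_sigma']
  refine sum_bij' (fun p _ => ⟨p.2, p.1 \ p.2⟩) (fun p _ => ⟨p.1 ∪ p.2, p.1⟩) ?_ ?_ ?_ ?_ ?_
  · rintro ⟨J, K⟩ h
    simp only [mem_sigma, mem_powerset] at h ⊢
    exact ⟨h.2.trans h.1, sdiff_subset_sdiff h.1 subset_rfl⟩
  · rintro ⟨K, L⟩ h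
    simp only [mem_sigma, mem_powerset] at h ⊢
    exact ⟨union_subset h.1 (h.2.trans sdiff_subset), subset_union_left⟩
  · rintro ⟨J, K⟩ h
    simp only [mem_sigma, mem_powerset] at h
    simp [union_sdiff_of_subset h.2]
  · rintro ⟨K, L⟩ h
    simp only [mem_sigma, mem_powerset] at h
    have : Disjoint K L := (disjoint_sdiff.mono_right h.2)
    simp [union_sdiff_cancel_left this]
  · rintro ⟨J, K⟩ h
    simp only [mem_sigma, mem_powerset] at h
    simp only [sdiff_sdiff_left, sup_eq_union, union_sdiff_of_subset h.2]

instance : CommRing (SetFun ι B) where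
  left_distrib f h k := by
    ext I; simp only [mul_apply, add_apply, mul_add, sum_add_distrib]
  right_distrib f h k := by
    ext I; simp only [mul_apply, add_apply, add_mul, sum_add_distrib]
  zero_mul f := by ext I; simp [mul_apply]
  mul_zero f := by ext I; simp [mul_apply]
  mul_assoc f h k := by
    ext I
    simp only [mul_apply, mul_sum, sum_mul]
    rw [sum_powerset_powerset I (fun K L M => f K * h L * k M)]
    simp only [mul_assoc]
  one_mul f := by
    ext I
    rw [mul_apply, sum_eq_single ∅]
    · simp [one_apply]
    · intro J _ hJ; simp [one_apply, hJ]
    · simp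
  mul_one f := by
    ext I
    rw [mul_apply, sum_eq_single I]
    · simp [one_apply]
    · intro J hJ hne
      have : ¬ I ⊆ J := fun h => hne (subset_antisymm (mem_powerset.1 hJ) h)
      simp [one_apply, sdiff_eq_empty_iff_subset, this]
    · simp
  mul_comm f h := by
    ext I
    rw [mul_apply, mul_apply, sum_powerset_sdiff_swap I (fun J K => f J * h K)]
    simp only [mul_comm]
  add_assoc f h k := by ext I; simp [add_assoc]
  zero_add f := by ext I; simp
  add_zero f := by ext I; simp
  add_comm f h := by ext I; simp [add_comm]
  nsmul := nsmulRec
  zsmul := zsmulRec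
  neg_add_cancel f := by ext I; simp
  sub_eq_add_neg f h := by ext I; simp [sub_eq_add_neg]

/-- A product in `SetFun` at `insert j I`. -/
lemma mul_insert (f h : SetFun ι B) {I : Finset ι} {j : ι} (hj : j ∉ I) :
    (f * h) (insert j I) =
      ∑ J ∈ I.powerset, (f (insert j J) * h (I \ J) + f J * h (insert j (I \ J))) := by
  rw [mul_apply, sum_powerset_insert hj, ← sum_add_distrib]
  refine sum_congr rfl fun J hJ => ?_
  have hjJ : j ∉ J := fun h => hj (mem_powerset.1 hJ h)
  rw [insert_sdiff_of_notMem _ hjJ, insert_sdiff_insert, sdiff_insert_of_notMem hj, add_comm]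

end SetFun

lemma natCast_mul_cancel {A : Type*} [CommRing A] [Algebra ℚ A] {k : ℕ} (hk : k ≠ 0) {a b : A}
    (h : (k : A) * a = k * b) : a = b := by
  have hu : algebraMap ℚ A (1 / k) * (k : A) = 1 := by
    rw [← map_natCast (algebraMap ℚ A) k, ← map_mul, one_div_mul_cancel (by exact_mod_cast hk),
      map_one]
  calc a = algebraMap ℚ A (1 / k) * (k * a) := by rw [← mul_assoc, hu, one_mul]
    _ = b := by rw [h, ← mul_assoc, hu, one_mul]

/-- The derivation of `A⟦λ⟧` multiplying `λ^g` by `2g`. -/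
def genusDer (A : Type*) [CommRing A] : Derivation A (PowerSeries A) (PowerSeries A) :=
  (2 * PowerSeries.X : PowerSeries A) • PowerSeries.derivative A

lemma coeff_genusDer {A : Type*} [CommRing A] (f : PowerSeries A) (g : ℕ) :
    PowerSeries.coeff g (genusDer A f) = 2 * g * PowerSeries.coeff g f := by
  have h2 : (2 : PowerSeries A) = PowerSeries.C 2 := (map_ofNat _ 2).symm
  rw [genusDer, Derivation.smul_apply, smul_eq_mul, mul_assoc, h2, PowerSeries.coeff_C_mul]
  cases g with
  | zero => simp
  | succ g =>
    rw [PowerSeries.coeff_succ_X_mul, PowerSeries.coeff_derivative]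
    push_cast; ring

lemma genusDer_mul {A : Type*} [CommRing A] (f h : PowerSeries A) :
    genusDer A (f * h) = genusDer A f * h + f * genusDer A h := by
  rw [Derivation.leibniz, smul_eq_mul, smul_eq_mul]; ring

lemma genusDer_C_mul {A : Type*} [CommRing A] (a : A) (f : PowerSeries A) :
    genusDer A (PowerSeries.C a * f) = PowerSeries.C a * genusDer A f := by
  ext g; simp only [coeff_genusDer, PowerSeries.coeff_C_mul]; ring

/-- The sum of the variables indexed by `I`. -/
def varSum {ι A : Type*} [CommRing A] (x : ι → A) (I : Finset ι) : A := ∑ i ∈ I, x i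

lemma varSum_add_sdiff {ι A : Type*} [DecidableEq ι] [CommRing A] (x : ι → A)
    {I J : Finset ι} (h : J ∈ I.powerset) : varSum x J + varSum x (I \ J) = varSum x I := by
  rw [add_comm]; exact sum_sdiff (mem_powerset.1 h)

lemma varSum_insert {ι A : Type*} [DecidableEq ι] [CommRing A] (x : ι → A)
    {I : Finset ι} {j : ι} (h : j ∉ I) : varSum x (insert j I) = varSum x I + x j := by
  rw [varSum, sum_insert h, add_comm]; rfl

lemma card_add_card_sdiff' {ι : Type*} [DecidableEq ι] {I J : Finset ι}
    (h : J ∈ I.powerset) : J.card + (I \ J).card = I.card := by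
  rw [add_comm]; exact card_sdiff_add_card_eq_card (mem_powerset.1 h)

/-- The recursion (in the number of points and the genus) satisfied by the family
`(Σ_{i ∈ I} x_i)^2 F_g(x_I)`, as power series in the genus variable. -/
structure IsTwoPuncture {ι A : Type*} [DecidableEq ι] [CommRing A] (x : ι → A)
    (f : SetFun ι (PowerSeries A)) : Prop where
  empty : f ∅ = 0
  single : ∀ i, PowerSeries.coeff 0 (f {i}) = 1
  eqn : ∀ I, 12 * (genusDer A (f I) + (I.card : PowerSeries A) * f I - f I)
    = PowerSeries.X * (PowerSeries.C (varSum x I)) ^ 3 * f I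
      + 6 * PowerSeries.C (varSum x I) * (f * f) I

/-- The coefficient of `X * f`. -/
lemma coeff_X_mul_ite {A : Type*} [CommRing A] (f : PowerSeries A) (g : ℕ) :
    PowerSeries.coeff g (PowerSeries.X * f)
      = if g = 0 then 0 else PowerSeries.coeff (g - 1) f := by
  cases g with
  | zero => simp
  | succ g => simp [PowerSeries.coeff_succ_X_mul]

lemma coeff_natCast_mul {A : Type*} [CommRing A] (k : ℕ) (f : PowerSeries A) (g : ℕ) :
    PowerSeries.coeff g ((k : PowerSeries A) * f) = k * PowerSeries.coeff g f := by
  rw [← map_natCast (PowerSeries.C (R := A)) k, PowerSeries.coeff_C_mul]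

lemma coeff_ofNat_mul {A : Type*} [CommRing A] (k : ℕ) [k.AtLeastTwo] (f : PowerSeries A) (g : ℕ) :
    PowerSeries.coeff g ((ofNat(k) : PowerSeries A) * f) = ofNat(k) * PowerSeries.coeff g f := by
  rw [← map_ofNat (PowerSeries.C (R := A)) k, PowerSeries.coeff_C_mul]

namespace IsTwoPuncture

variable {ι A : Type*} [DecidableEq ι] [CommRing A] {x : ι → A} {f : SetFun ι (PowerSeries A)}

/-- The recursion, coefficientwise. -/
lemma coeff_eqn (h : IsTwoPuncture x f) (I : Finset ι) (g : ℕ) :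
    12 * (2 * g + I.card - 1) * PowerSeries.coeff g (f I)
      = (varSum x I) ^ 3 * (if g = 0 then 0 else PowerSeries.coeff (g - 1) (f I))
        + 6 * varSum x I * PowerSeries.coeff g ((f * f) I) := by
  have := congrArg (PowerSeries.coeff g) (h.eqn I)
  rw [coeff_ofNat_mul, map_sub, map_add, coeff_genusDer, coeff_natCast_mul, map_add,
    ← map_pow, mul_assoc PowerSeries.X, coeff_X_mul_ite, PowerSeries.coeff_C_mul,
    mul_assoc (6 : PowerSeries A), coeff_ofNat_mul,
    PowerSeries.coeff_C_mul] at this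
  rw [mul_assoc (6 : A), mul_ite, mul_zero, ← this]; ring

lemma sq_congr {f f' : SetFun ι (PowerSeries A)} (h : f ∅ = 0) (h' : f' ∅ = 0) {I : Finset ι}
    (hI : ∀ J, J ⊂ I → f J = f' J) : (f * f) I = (f' * f') I := by
  rw [SetFun.mul_apply, SetFun.mul_apply]
  refine sum_congr rfl fun J hJ => ?_
  rw [mem_powerset] at hJ
  rcases eq_or_ne J ∅ with rfl | h1
  · simp [h, h']
  rcases eq_or_ne J I with rfl | h2
  · simp [h, h']
  rw [hI J (hJ.ssubset_of_ne h2), hI (I \ J) (sdiff_ssubset hJ (nonempty_iff_ne_empty.2 h1))]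

lemma unique [Algebra ℚ A] {f f' : SetFun ι (PowerSeries A)} (h : IsTwoPuncture x f)
    (h' : IsTwoPuncture x f') : f = f' := by
  ext1
  funext I
  induction I using Finset.strongInduction with
  | H I ih =>
    rcases I.eq_empty_or_nonempty with rfl | hne
    · rw [h.empty, h'.empty]
    have hsq := sq_congr h.empty h'.empty ih
    ext g
    induction g with
    | zero =>
      by_cases hc : I.card = 1
      · obtain ⟨i, rfl⟩ := card_eq_one.1 hc
        rw [h.single, h'.single]
      · have hpos := hne.card_pos
        obtain ⟨k, hk⟩ : ∃ k, I.card = k + 2 := ⟨I.card - 2, by omega⟩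
        have e1 := h.coeff_eqn I 0
        have e2 := h'.coeff_eqn I 0
        rw [hsq, if_pos rfl] at e1
        rw [if_pos rfl, ← e1] at e2
        refine natCast_mul_cancel (k := 12 * (k + 1)) (by omega) ?_
        rw [hk] at e2
        push_cast at e2 ⊢
        linear_combination -e2
    | succ g ihg =>
      have hpos := hne.card_pos
      obtain ⟨k, hk⟩ : ∃ k, I.card = k + 1 := ⟨I.card - 1, by omega⟩
      have e1 := h.coeff_eqn I (g + 1)
      have e2 := h'.coeff_eqn I (g + 1)
      rw [hsq, if_neg (by omega), Nat.add_sub_cancel, ihg] at e1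
      rw [if_neg (by omega), Nat.add_sub_cancel, ← e1] at e2
      refine natCast_mul_cancel (k := 12 * (2 * (g + 1) + k)) (by omega) ?_
      rw [hk] at e2
      push_cast at e2 ⊢
      linear_combination -e2

/-- Ring homomorphisms preserve the recursion. -/
lemma map {B : Type*} [CommRing B] (φ : A →+* B) (h : IsTwoPuncture x f) :
    IsTwoPuncture (φ ∘ x) ⟨fun I => PowerSeries.map φ (f I)⟩ where
  empty := by simp [h.empty]
  single i := by simp [h.single]
  eqn I := by
    have hv : varSum (φ ∘ x) I = φ (varSum x I) := by simp [varSum]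
    have hD : genusDer B (PowerSeries.map φ (f I)) = PowerSeries.map φ (genusDer A (f I)) := by
      ext g; simp [coeff_genusDer, map_ofNat φ 2]
    have := congrArg (PowerSeries.map φ) (h.eqn I)
    simp only [map_mul, map_add, map_sub, map_ofNat, map_natCast, map_pow, PowerSeries.map_X,
      PowerSeries.map_C] at this
    rw [hv, hD, this, SetFun.mul_apply, SetFun.mul_apply, map_sum]
    simp only [map_mul]

/-- Restricting to the image of an injection preserves the recursion. -/
lemma comap {κ : Type*} [DecidableEq κ] (e : κ ↪ ι) (h : IsTwoPuncture x f) :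
    IsTwoPuncture (x ∘ e) ⟨fun I => f (I.map e)⟩ where
  empty := by simp [h.empty]
  single i := by simp [h.single]
  eqn I := by
    have hv : varSum (x ∘ e) I = varSum x (I.map e) := by simp [varSum]
    have hm : ((⟨fun I => f (I.map e)⟩ : SetFun κ (PowerSeries A)) * ⟨fun I => f (I.map e)⟩) I
        = (f * f) (I.map e) := by
      rw [SetFun.mul_apply, SetFun.mul_apply]
      refine sum_bij (fun J _ => J.map e) ?_ ?_ ?_ ?_
      · intro J hJ
        exact mem_powerset.2 (map_subset_map.2 (mem_powerset.1 hJ))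
      · intro J _ J' _ hh; exact map_injective e hh
      · intro J hJ
        obtain ⟨J', hJ', rfl⟩ := (subset_map_iff.1 (mem_powerset.1 hJ))
        exact ⟨J', mem_powerset.2 hJ', rfl⟩
      · intro J _
        rw [← Finset.map_sdiff]
    have := h.eqn (I.map e)
    rw [card_map] at this
    rw [hv, hm, this]

/-- Outside the cases `(g, n) = (0, 1), (0, 2)` the solution is divisible by the square of the
sum of the variables. -/
lemma exists_eq_sq_mul [Algebra ℚ A] (h : IsTwoPuncture x f) {I : Finset ι} {g : ℕ}
    (hg : 2 < 2 * g + I.card) :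
    ∃ q, PowerSeries.coeff g (f I) = varSum x I ^ 2 * q := by
  let E : SetFun ι (PowerSeries A) → SetFun ι (PowerSeries A) := fun u =>
    ⟨fun I => genusDer A (u I) + (I.card : PowerSeries A) * u I⟩
  let P : SetFun ι (PowerSeries A) → SetFun ι (PowerSeries A) := fun u =>
    ⟨fun I => PowerSeries.C (varSum x I) * u I⟩
  let L : SetFun ι (PowerSeries A) → SetFun ι (PowerSeries A) := fun u =>
    ⟨fun I => PowerSeries.X * u I⟩
  have hP : ∀ u v, P (u * v) = P u * v + u * P v := by
    intro u v
    ext1; funext J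
    simp only [P, SetFun.mul_apply, SetFun.add_apply, mul_sum, ← sum_add_distrib]
    refine sum_congr rfl fun K hK => ?_
    rw [← varSum_add_sdiff x hK, map_add]; ring
  have hPa : ∀ u v, P (u + v) = P u + P v := by
    intro u v; ext1; funext J; simp only [P, SetFun.add_apply]; ring
  have hPs : ∀ u v, P (u - v) = P u - P v := by
    intro u v; ext1; funext J; simp only [P, SetFun.sub_apply]; ring
  have hE : ∀ u v, E (u * v) = E u * v + u * E v := by
    intro u v
    ext1; funext J
    simp only [E, SetFun.mul_apply, SetFun.add_apply, mul_sum, ← sum_add_distrib, map_sum]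
    refine sum_congr rfl fun K hK => ?_
    rw [genusDer_mul, ← card_add_card_sdiff' hK]; push_cast; ring
  have hL : ∀ u v, L u * v = L (u * v) := by
    intro u v; ext1; funext J
    simp only [L, SetFun.mul_apply, mul_sum, mul_assoc]
  have hPL : ∀ u, P (L u) = L (P u) := by
    intro u; ext1; funext J; simp only [L, P]; ring
  have hsm : ∀ (k : ℕ) (u : SetFun ι (PowerSeries A)) (J : Finset ι),
      ((k : SetFun ι (PowerSeries A)) * u) J = (k : PowerSeries A) * u J := by
    intro k u J
    induction k with
    | zero => simp
    | succ k ih => rw [Nat.cast_succ, add_mul, one_mul, SetFun.add_apply, ih]; push_cast; ring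
  have hfun : 12 * (E f - f) = L (P (P (P f))) + 6 * P (f * f) := by
    ext1; funext J
    have := h.eqn J
    rw [SetFun.add_apply]
    rw [show (12 : SetFun ι (PowerSeries A)) = ((12 : ℕ) : _) from rfl,
      show (6 : SetFun ι (PowerSeries A)) = ((6 : ℕ) : _) from rfl, hsm, hsm]
    simp only [E, P, L, SetFun.sub_apply]
    push_cast
    rw [this]; ring
  have key : 12 * (E (f * f) - 2 * (f * f))
      = P (L (f * P (P f)) + L (f * P (P f)) - L (P f * P f) + 8 * (f * f * f)) := by
    have h8 : (8 : SetFun ι (PowerSeries A)) * (f * f * f) =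
        f * f * f + f * f * f + f * f * f + f * f * f + f * f * f + f * f * f + f * f * f
          + f * f * f := by ring
    have hLc : ∀ u v, v * L u = L (u * v) := fun u v => by rw [mul_comm, hL]
    rw [h8, hE]
    simp only [hPa, hPs, hPL, hP]
    have e1 := hL (P (P (P f))) f
    have hLa : ∀ u v, L (u + v) = L u + L v := by
      intro u v; ext1; funext J; simp only [L, SetFun.add_apply]; ring
    rw [hP] at hfun
    simp only [hLa]
    rw [mul_comm (P f) (P (P f)), mul_comm f (P (P (P f))), ← e1]
    linear_combination (2 * f) * hfun
  have hI := congrArg (fun u => PowerSeries.coeff g (SetFun.toFun u I)) key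
  obtain ⟨q, hq⟩ : ∃ q, 12 * (2 * g + I.card - 2) * PowerSeries.coeff g ((f * f) I)
      = varSum x I * q := by
    refine ⟨_, Eq.trans ?_ (hI.trans (PowerSeries.coeff_C_mul _ _ _))⟩
    rw [show (12 : SetFun ι (PowerSeries A)) = ((12 : ℕ) : _) from rfl,
      show (2 : SetFun ι (PowerSeries A)) = ((2 : ℕ) : _) from rfl, hsm, SetFun.sub_apply, hsm]
    rw [coeff_natCast_mul, map_sub, coeff_natCast_mul]
    simp only [E]
    rw [map_add, coeff_genusDer, coeff_natCast_mul]
    push_cast; ring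
  have hinv : ∀ k : ℕ, k ≠ 0 → ∃ r : A, r * k = 1 := by
    intro k hk
    refine ⟨algebraMap ℚ A (1 / k), ?_⟩
    rw [← map_natCast (algebraMap ℚ A) k, ← map_mul, one_div_mul_cancel (by exact_mod_cast hk),
      map_one]
  obtain ⟨k, hk⟩ : ∃ k, 2 * g + I.card = k + 3 := ⟨2 * g + I.card - 3, by omega⟩
  have hk' : (2 * g + I.card : A) = k + 3 := by exact_mod_cast congrArg (Nat.cast (R := A)) hk
  obtain ⟨r, hr⟩ := hinv (12 * (k + 1)) (by omega)
  obtain ⟨s, hs⟩ := hinv (12 * (k + 2)) (by omega)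
  have hc := h.coeff_eqn I g
  rw [hk'] at hc hq
  push_cast at hr hs
  refine ⟨s * (varSum x I * (if g = 0 then 0 else PowerSeries.coeff (g - 1) (f I)) + 6 * r * q), ?_⟩
  linear_combination s * hc + (-PowerSeries.coeff g (f I)) * hs
    + 6 * varSum x I * s * r * hq - 6 * varSum x I * s * PowerSeries.coeff g ((f * f) I) * hr

end IsTwoPuncture

/-- Solving the genus recursion `12 (2g + n - 1) u_g = p^3 u_{g-1} + s_g` with given `u_0`. -/
def genusSolve {A : Type*} [CommRing A] [Algebra ℚ A] (n : ℕ) (p u : A) (s : ℕ → A) : ℕ → A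
  | 0 => u
  | g + 1 => algebraMap ℚ A (1 / (12 * (2 * (g + 1) + n - 1))) *
      (p ^ 3 * genusSolve n p u s g + s (g + 1))

/-- The family `(Σ_{i ∈ I} x_i)^2 F_g(x_I)`, constructed from its recursion. -/
def twoPunctureFun {ι A : Type*} [DecidableEq ι] [CommRing A] [Algebra ℚ A] (x : ι → A)
    (I : Finset ι) : PowerSeries A :=
  if I = ∅ then 0
  else
    let s : PowerSeries A := ∑ J ∈ I.ssubsets.attach,
      if J.1 = ∅ then 0 else
        twoPunctureFun x J.1 * (if J.1 = ∅ then 0 else twoPunctureFun x (I \ J.1))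
    PowerSeries.mk (genusSolve I.card (varSum x I)
      (if I.card = 1 then 1 else algebraMap ℚ A (1 / (12 * (I.card - 1))) *
        (6 * varSum x I * PowerSeries.coeff 0 s))
      (fun g => 6 * varSum x I * PowerSeries.coeff g s))
termination_by I.card
decreasing_by
  · exact card_lt_card (mem_ssubsets.1 J.2)
  · exact card_lt_card (sdiff_ssubset (mem_ssubsets.1 J.2).subset
      (nonempty_iff_ne_empty.2 (by assumption)))

/-- The family `(Σ_{i ∈ I} x_i)^2 F_g(x_I)` as an element of `SetFun`. -/
def twoPuncture {ι A : Type*} [DecidableEq ι] [CommRing A] [Algebra ℚ A] (x : ι → A) :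
    SetFun ι (PowerSeries A) := ⟨twoPunctureFun x⟩

section

variable {ι A : Type*} [DecidableEq ι] [CommRing A] [Algebra ℚ A] (x : ι → A)

lemma twoPuncture_empty : twoPuncture x ∅ = 0 := by
  rw [twoPuncture]; dsimp only; rw [twoPunctureFun, if_pos rfl]

lemma twoPuncture_eq {I : Finset ι} (hI : I ≠ ∅) :
    twoPuncture x I = PowerSeries.mk (genusSolve I.card (varSum x I)
      (if I.card = 1 then 1 else algebraMap ℚ A (1 / (12 * (I.card - 1))) *
        (6 * varSum x I * PowerSeries.coeff 0 ((twoPuncture x * twoPuncture x) I)))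
      (fun g => 6 * varSum x I * PowerSeries.coeff g ((twoPuncture x * twoPuncture x) I))) := by
  have hs : (∑ J ∈ I.ssubsets.attach,
      if J.1 = ∅ then (0 : PowerSeries A) else
        twoPunctureFun x J.1 * (if J.1 = ∅ then 0 else twoPunctureFun x (I \ J.1)))
      = (twoPuncture x * twoPuncture x) I := by
    rw [sum_attach I.ssubsets (fun J => if J = ∅ then (0 : PowerSeries A) else
        twoPunctureFun x J * (if J = ∅ then 0 else twoPunctureFun x (I \ J))),
      SetFun.mul_apply]
    refine sum_subset_zero_on_sdiff ?_ ?_ ?_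
    · intro J hJ
      exact mem_powerset.2 (mem_ssubsets.1 hJ).subset
    · intro J hJ
      simp only [mem_sdiff, mem_powerset, mem_ssubsets] at hJ
      have : J = I := by
        by_contra hne
        exact hJ.2 (hJ.1.ssubset_of_ne hne)
      rw [this, sdiff_self]
      exact (congrArg _ (twoPuncture_empty x)).trans (mul_zero _)
    · intro J _
      split_ifs with h
      · rw [h, twoPuncture_empty, zero_mul]
      · rfl
  conv_lhs => rw [twoPuncture]; dsimp only; rw [twoPunctureFun, if_neg hI]
  rw [hs]

lemma natCast_mul_algebraMap_one_div {k : ℕ} {r : ℚ} (hk : k ≠ 0) (hr : r = k) (a : A) :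
    (k : A) * (algebraMap ℚ A (1 / r) * a) = a := by
  rw [← mul_assoc, ← map_natCast (algebraMap ℚ A) k, ← map_mul, hr,
    mul_one_div_cancel (by exact_mod_cast hk), map_one, one_mul]

lemma twoPuncture_spec : IsTwoPuncture x (twoPuncture x) where
  empty := twoPuncture_empty x
  single i := by
    rw [twoPuncture_eq x (singleton_ne_empty i)]
    simp [genusSolve]
  eqn I := by
    rcases I.eq_empty_or_nonempty with rfl | hne
    · simp [twoPuncture_empty, SetFun.mul_apply]
    set S := (twoPuncture x * twoPuncture x) I with hS
    have he := twoPuncture_eq x hne.ne_empty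
    rw [← hS] at he
    have hpos := hne.card_pos
    obtain ⟨k, hk⟩ : ∃ k, I.card = k + 1 := ⟨I.card - 1, by omega⟩
    ext g
    rw [coeff_ofNat_mul, map_sub, map_add, coeff_genusDer, coeff_natCast_mul, map_add,
      ← map_pow, mul_assoc PowerSeries.X, coeff_X_mul_ite, PowerSeries.coeff_C_mul,
      mul_assoc (6 : PowerSeries A), coeff_ofNat_mul, PowerSeries.coeff_C_mul]
    cases g with
    | zero =>
      rw [if_pos rfl, he, PowerSeries.coeff_mk, genusSolve]
      split_ifs with h1
      · obtain ⟨i, rfl⟩ := card_eq_one.1 h1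
        have hS0 : S = 0 := by
          rw [hS, SetFun.mul_apply]
          refine sum_eq_zero fun J hJ => ?_
          rcases subset_singleton_iff.1 (mem_powerset.1 hJ) with rfl | rfl
          · rw [twoPuncture_empty, zero_mul]
          · rw [sdiff_self]; exact (congrArg _ (twoPuncture_empty x)).trans (mul_zero _)
        rw [hS0]; simp
      · have hk0 : k ≠ 0 := by omega
        have := natCast_mul_algebraMap_one_div (A := A) (k := 12 * k)
          (r := 12 * ((I.card : ℚ) - 1)) (by omega) (by rw [hk]; push_cast; ring)
          (6 * varSum x I * PowerSeries.coeff 0 S)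
        rw [hk] at this ⊢
        push_cast at this ⊢
        linear_combination this
    | succ g =>
      rw [if_neg (by omega), Nat.add_sub_cancel]
      conv_lhs => rw [he]
      conv_rhs => rw [he]
      rw [PowerSeries.coeff_mk, PowerSeries.coeff_mk, genusSolve]
      have := natCast_mul_algebraMap_one_div (A := A) (k := 12 * (2 * (g + 1) + k))
          (r := (12 * (2 * ((g : ℚ) + 1) + I.card - 1))) (by omega)
          (by rw [hk]; push_cast; ring)
          (varSum x I ^ 3 * genusSolve I.card (varSum x I)
            (if I.card = 1 then 1 else algebraMap ℚ A (1 / (12 * (I.card - 1))) *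
              (6 * varSum x I * PowerSeries.coeff 0 S))
            (fun g => 6 * varSum x I * PowerSeries.coeff g S) g +
              6 * varSum x I * PowerSeries.coeff (g + 1) S)
      rw [hk] at this ⊢
      push_cast at this ⊢
      linear_combination this

lemma map_twoPuncture {B : Type*} [CommRing B] [Algebra ℚ B] (φ : A →+* B) (I : Finset ι) :
    PowerSeries.map φ (twoPuncture x I) = twoPuncture (φ ∘ x) I :=
  congrArg (fun f => SetFun.toFun f I)
    (((twoPuncture_spec x).map φ).unique (twoPuncture_spec (φ ∘ x)))

lemma twoPuncture_map {κ : Type*} [DecidableEq κ] (e : κ ↪ ι) (I : Finset κ) :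
    twoPuncture x (I.map e) = twoPuncture (x ∘ e) I :=
  congrArg (fun f => SetFun.toFun f I)
    (((twoPuncture_spec x).comap e).unique (twoPuncture_spec (x ∘ e)))

lemma coeff_twoPuncture_zero_single (i : ι) : PowerSeries.coeff 0 (twoPuncture x {i}) = 1 :=
  (twoPuncture_spec x).single i

end

section

variable {ι A : Type*} [DecidableEq ι] [Field A] [Algebra ℚ A]

/-- The exponential `exp (c λ)`. -/
def expSeries (c : A) : PowerSeries A := PowerSeries.rescale c (PowerSeries.exp A)

lemma coeff_expSeries (c : A) (k : ℕ) :
    PowerSeries.coeff k (expSeries c) = algebraMap ℚ A (1 / k.factorial) * c ^ k := by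
  rw [expSeries, PowerSeries.coeff_rescale, PowerSeries.coeff_exp, mul_comm]

lemma expSeries_add (c c' : A) : expSeries (c + c') = expSeries c * expSeries c' :=
  (PowerSeries.exp_mul_exp_eq_exp_add c c').symm

lemma expSeries_zero : expSeries (0 : A) = 1 := by
  ext k; rw [coeff_expSeries, PowerSeries.coeff_one]
  split_ifs with h
  · subst h; simp
  · simp [h]

lemma map_expSeries {B : Type*} [Field B] [Algebra ℚ B] (φ : A →+* B) (c : A) :
    PowerSeries.map φ (expSeries c) = expSeries (φ c) := by
  ext k
  rw [PowerSeries.coeff_map, coeff_expSeries, coeff_expSeries, map_mul, map_pow,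
    ← RingHom.comp_apply, Subsingleton.elim (φ.comp (algebraMap ℚ A)) (algebraMap ℚ B)]

lemma genusDer_expSeries (c : A) :
    genusDer A (expSeries c) = 2 * PowerSeries.C c * (PowerSeries.X * expSeries c) := by
  ext k
  rw [coeff_genusDer, mul_assoc (2 : PowerSeries A), coeff_ofNat_mul, PowerSeries.coeff_C_mul,
    coeff_X_mul_ite]
  cases k with
  | zero => simp
  | succ k =>
    rw [if_neg (by omega), Nat.add_sub_cancel, coeff_expSeries, coeff_expSeries]
    have : algebraMap ℚ A (1 / k.factorial) =
        (k + 1) * algebraMap ℚ A (1 / (k + 1).factorial) := by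
      rw [show ((k : A) + 1) = algebraMap ℚ A (k + 1) by
        rw [map_add, map_natCast, map_one], ← map_mul]
      congr 1
      rw [Nat.factorial_succ]; push_cast
      have : (k.factorial : ℚ) ≠ 0 := by exact_mod_cast k.factorial_ne_zero
      field_simp
    rw [this]; push_cast; ring

/-- The family `(Σ_{i ∈ I} x_i)^2 G_g(x_I)`. -/
def normPuncture (x : ι → A) : SetFun ι (PowerSeries A) :=
  ⟨fun I => expSeries (-varSum (fun i => x i ^ 3) I / 24) * twoPuncture x I⟩

lemma normPuncture_empty (x : ι → A) : normPuncture x ∅ = 0 := by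
  simp [normPuncture, twoPuncture_empty]

lemma expSeries_mul_normPuncture (x : ι → A) (I : Finset ι) :
    expSeries (varSum (fun i => x i ^ 3) I / 24) * normPuncture x I = twoPuncture x I := by
  rw [normPuncture]; dsimp only
  rw [← mul_assoc, ← expSeries_add, neg_div, add_neg_cancel, expSeries_zero, one_mul]

lemma map_normPuncture {B : Type*} [Field B] [Algebra ℚ B] (φ : A →+* B) (x : ι → A)
    (I : Finset ι) : PowerSeries.map φ (normPuncture x I) = normPuncture (φ ∘ x) I := by
  simp only [normPuncture, map_mul, map_twoPuncture, map_expSeries]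
  congr 2
  simp [varSum, map_ofNat φ 24]

lemma normPuncture_map {κ : Type*} [DecidableEq κ] (x : ι → A) (e : κ ↪ ι) (I : Finset κ) :
    normPuncture x (I.map e) = normPuncture (x ∘ e) I := by
  simp only [normPuncture, twoPuncture_map]
  congr 2
  simp [varSum]

lemma normPuncture_mul_self (x : ι → A) (I : Finset ι) :
    (normPuncture x * normPuncture x) I = expSeries (-varSum (fun i => x i ^ 3) I / 24) *
      (twoPuncture x * twoPuncture x) I := by
  rw [SetFun.mul_apply, SetFun.mul_apply, mul_sum]
  refine sum_congr rfl fun J hJ => ?_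
  rw [← varSum_add_sdiff _ hJ, neg_add, add_div, expSeries_add]
  simp only [normPuncture]; ring

lemma normPuncture_coeff_eqn (x : ι → A) (I : Finset ι) (g : ℕ) :
    (2 * g + I.card - 1) * PowerSeries.coeff g (normPuncture x I)
      = (varSum x I ^ 3 - varSum (fun i => x i ^ 3) I) / 3 / 4 *
          (if g = 0 then 0 else PowerSeries.coeff (g - 1) (normPuncture x I))
        + varSum x I / 2 * PowerSeries.coeff g ((normPuncture x * normPuncture x) I) := by
  have hc : CharZero A := algebraRat.charZero A
  have h := (twoPuncture_spec x).eqn I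
  set e := expSeries (-varSum (fun i => x i ^ 3) I / 24) with he
  set q := varSum (fun i => x i ^ 3) I with hq
  have h24 : 24 * PowerSeries.C (-q / 24) = -PowerSeries.C q := by
    rw [← map_ofNat (PowerSeries.C (R := A)) 24, ← map_mul, ← map_neg]
    congr 1; ring
  have hS := normPuncture_mul_self x I
  have hn : normPuncture x I = e * twoPuncture x I := rfl
  have key : 12 * (genusDer A (normPuncture x I) + (I.card : PowerSeries A) * normPuncture x I
        - normPuncture x I)
      = PowerSeries.X * ((PowerSeries.C (varSum x I) ^ 3 - PowerSeries.C q) * normPuncture x I)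
        + 6 * (PowerSeries.C (varSum x I) * (normPuncture x * normPuncture x) I) := by
    rw [hS, hn, genusDer_mul, he, genusDer_expSeries, ← he]
    linear_combination e * h + PowerSeries.X * e * twoPuncture x I * h24
  have := congrArg (PowerSeries.coeff g) key
  rw [coeff_ofNat_mul, map_sub, map_add, coeff_genusDer, coeff_natCast_mul, map_add,
    coeff_X_mul_ite, ← map_pow, ← map_sub, PowerSeries.coeff_C_mul, coeff_ofNat_mul,
    PowerSeries.coeff_C_mul] at this
  split_ifs at this ⊢ <;> linear_combination this / 12

lemma coeff_zero_normPuncture_single (x : ι → A) (i : ι) :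
    PowerSeries.coeff 0 (normPuncture x {i}) = 1 := by
  rw [normPuncture]; dsimp only
  rw [PowerSeries.coeff_mul]
  simp [coeff_expSeries, coeff_twoPuncture_zero_single, -PowerSeries.coeff_zero_eq_constantCoeff]

lemma normPuncture_mul_self_single (x : ι → A) (i : ι) :
    (normPuncture x * normPuncture x) {i} = 0 := by
  rw [SetFun.mul_apply]
  refine sum_eq_zero fun J hJ => ?_
  rcases subset_singleton_iff.1 (mem_powerset.1 hJ) with rfl | rfl
  · rw [normPuncture_empty, zero_mul]
  · rw [sdiff_self]; exact (congrArg _ (normPuncture_empty x)).trans (mul_zero _)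

lemma coeff_succ_normPuncture_single (x : ι → A) (i : ι) (g : ℕ) :
    PowerSeries.coeff (g + 1) (normPuncture x {i}) = 0 := by
  have hc : CharZero A := algebraRat.charZero A
  have h := normPuncture_coeff_eqn x {i} (g + 1)
  rw [normPuncture_mul_self_single] at h
  have hg : (g : A) + 1 ≠ 0 := Nat.cast_add_one_ne_zero g
  simpa [varSum, hg] using h

/-- The closed solution of the recursion for the normalized functions. -/
lemma coeff_normPuncture (x : ι → A) {I : Finset ι} {n : ℕ} (hI : I.card = n + 2) (g : ℕ) :
    PowerSeries.coeff g (normPuncture x I) = ∑ s ∈ range (g + 1),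
      ((Nat.doubleFactorial (2 * (g - s) + (n + 2) - 3) : A) /
          (4 ^ s * (Nat.doubleFactorial (2 * g + (n + 2) - 1) : A))) *
        (varSum x I / 2 *
          PowerSeries.coeff (g - s) ((normPuncture x * normPuncture x) I)) *
        ((varSum x I ^ 3 - varSum (fun i => x i ^ 3) I) / 3) ^ s := by
  have hc : CharZero A := algebraRat.charZero A
  have hdf : ∀ k, (Nat.doubleFactorial k : A) ≠ 0 := fun k => by
    exact_mod_cast (Nat.doubleFactorial_pos k).ne'
  have hstep : ∀ k, (Nat.doubleFactorial (2 * k + (n + 2) - 1) : A)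
      = (2 * k + n + 1) * Nat.doubleFactorial (2 * k + (n + 2) - 3) := by
    intro k
    rcases Nat.eq_zero_or_pos (2 * k + n) with h0 | h0
    · obtain ⟨rfl, rfl⟩ : k = 0 ∧ n = 0 := by omega
      simp [Nat.doubleFactorial]
    · obtain ⟨m, hm⟩ : ∃ m, 2 * k + (n + 2) - 3 = m := ⟨_, rfl⟩
      rw [hm, show 2 * k + (n + 2) - 1 = m + 2 by omega, Nat.doubleFactorial_add_two]
      have : (2 * k + n + 1 : A) = m + 2 := by
        exact_mod_cast congrArg (Nat.cast (R := A)) (show 2 * k + n + 1 = m + 2 by omega)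
      rw [this]; push_cast; ring
  have hne : ∀ k : ℕ, (2 * k + n + 1 : A) ≠ 0 := fun k => by
    exact_mod_cast Nat.succ_ne_zero (2 * k + n)
  induction g with
  | zero =>
    have h := normPuncture_coeff_eqn x I 0
    rw [hI, if_pos rfl] at h
    have h1 := hstep 0
    have h2 := hne 0
    rw [sum_range_one, h1]
    push_cast at h h1 h2 ⊢
    simp only [mul_zero, zero_add, pow_zero, mul_one, one_mul] at *
    have h3 := hdf (n + 2 - 3)
    field_simp
    linear_combination 2 * h
  | succ g ih =>
    have h := normPuncture_coeff_eqn x I (g + 1)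
    rw [hI, if_neg (by omega), Nat.add_sub_cancel, ih, mul_sum] at h
    rw [sum_range_succ']
    apply mul_left_cancel₀ (hne (g + 1))
    have e : (2 * (g + 1 : ℕ) + n + 1 : A) = 2 * (g + 1 : ℕ) + (n + 2 : ℕ) - 1 := by
      push_cast; ring
    rw [e, h, ← e, mul_add, mul_sum]
    congr 1
    · refine sum_congr rfl fun s hs => ?_
      have h1 := hstep (g + 1)
      rw [show 2 * (g + 1) + (n + 2) - 3 = 2 * g + (n + 2) - 1 by omega] at h1
      rw [h1, show g + 1 - (s + 1) = g - s by omega]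
      have h2 := hne (g + 1)
      have h3 := hdf (2 * g + (n + 2) - 1)
      field_simp
      try ring
    · have h1 := hstep (g + 1)
      have h2 := hne (g + 1)
      have h3 := hdf (2 * (g + 1) + (n + 2) - 3)
      simp only [Nat.sub_zero, pow_zero, mul_one, one_mul]
      rw [h1]
      field_simp

end

/-- The variables as elements of `K n`. -/
def fracVar (n : ℕ) (i : Fin n) : K n := algebraMap (R n) (K n) (X i)

lemma varSum_fracVar {n : ℕ} (I : Finset (Fin n)) :
    varSum (fracVar n) I = algebraMap (R n) (K n) (∑ i ∈ I, X i) := by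
  rw [map_sum]; rfl

lemma SX_eq (n : ℕ) : SX n = varSum (fracVar n) univ := (varSum_fracVar univ).symm

lemma SX3_eq (n : ℕ) : SX3 n = varSum (fun i => fracVar n i ^ 3) univ := by
  simp [SX3, varSum, fracVar]

lemma Dlt_eq (n : ℕ) : Dlt n =
    (varSum (fracVar n) univ ^ 3 - varSum (fun i => fracVar n i ^ 3) univ) / 3 := by
  rw [Dlt, SX_eq, SX3_eq]

lemma SX_ne_zero {n : ℕ} (hn : n ≠ 0) : SX n ≠ 0 := by
  rw [SX, Ne, IsFractionRing.to_map_eq_zero_iff]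
  intro h
  have := congrArg (MvPolynomial.eval (fun _ => (1 : ℚ))) h
  simp [hn] at this

lemma emb_algebraMap {n : ℕ} (I : Finset (Fin n)) (p : R I.card) :
    emb I (algebraMap (R I.card) (K I.card) p) = embRH I p :=
  IsFractionRing.lift_algebraMap (embRH_inj I) p

/-- The increasing enumeration of `I` as an embedding. -/
def enumEmb {n : ℕ} (I : Finset (Fin n)) : Fin I.card ↪ Fin n where
  toFun i := (I.orderIsoOfFin rfl) i
  inj' _ _ h := (I.orderIsoOfFin rfl).injective (Subtype.val_injective h)

lemma map_enumEmb {n : ℕ} (I : Finset (Fin n)) : univ.map (enumEmb I) = I := by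
  ext j
  simp only [mem_map, mem_univ, true_and]
  constructor
  · rintro ⟨i, rfl⟩
    exact ((I.orderIsoOfFin rfl) i).2
  · intro hj
    exact ⟨(I.orderIsoOfFin rfl).symm ⟨j, hj⟩,
      congrArg Subtype.val ((I.orderIsoOfFin rfl).apply_symm_apply ⟨j, hj⟩)⟩

lemma emb_comp_fracVar {n : ℕ} (I : Finset (Fin n)) :
    emb I ∘ fracVar I.card = fracVar n ∘ enumEmb I := by
  funext i
  rw [Function.comp_apply, fracVar, emb_algebraMap]
  simp [embRH, fracVar, enumEmb]

lemma map_varSum {ι A B : Type*} [CommRing A] [CommRing B] (φ : A →+* B) (x : ι → A)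
    (I : Finset ι) : φ (varSum x I) = varSum (φ ∘ x) I := by
  simp [varSum]

lemma varSum_map {ι κ A : Type*} [CommRing A] (x : ι → A) (e : κ ↪ ι)
    (I : Finset κ) : varSum x (I.map e) = varSum (x ∘ e) I := by
  simp [varSum]

lemma SX_sq_mul_Gf_one (fuel g : ℕ) :
    SX 1 ^ 2 * Gf fuel 1 g = PowerSeries.coeff g (normPuncture (fracVar 1) univ) := by
  rw [univ_unique]
  cases g with
  | zero =>
    have h := SX_ne_zero (n := 1) one_ne_zero
    rw [coeff_zero_normPuncture_single, Gf]
    rw [SX, Fin.sum_univ_one] at h ⊢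
    rw [← zpow_natCast, ← zpow_add₀ h]; rfl
  | succ g => rw [coeff_succ_normPuncture_single, Gf, mul_zero]

/-- The recursively defined normalized functions agree with `normPuncture`. -/
lemma SX_sq_mul_Gf (fuel n g : ℕ) (hn : n ≠ 0) (hf : n ≤ fuel + 1) :
    SX n ^ 2 * Gf fuel n g = PowerSeries.coeff g (normPuncture (fracVar n) univ) := by
  induction fuel generalizing n g with
  | zero =>
    obtain rfl : n = 1 := by omega
    exact SX_sq_mul_Gf_one 0 g
  | succ fuel ih =>
    match n, hn, hf with
    | 1, _, _ => exact SX_sq_mul_Gf_one _ g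
    | n + 2, _, hf =>
      have hsub : ∀ I : Finset (Fin (n + 2)), I ≠ ∅ → I ≠ univ → ∀ r,
          (algebraMap (R (n + 2)) (K (n + 2)) (∑ i ∈ I, X i)) ^ 2 * emb I (Gf fuel I.card r)
            = PowerSeries.coeff r (normPuncture (fracVar (n + 2)) I) := by
        intro I h1 h2 r
        have hlt : I.card < n + 2 := by
          simpa using card_lt_univ_of_notMem (s := I)
            (x := (not_forall.1 (fun h => h2 (eq_univ_iff_forall.2 h))).choose)
            (not_forall.1 (fun h => h2 (eq_univ_iff_forall.2 h))).choose_spec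
        have h := congrArg (emb I) (ih I.card r (by simpa using h1) (by omega))
        rw [map_mul, map_pow, SX_eq, map_varSum, emb_comp_fracVar, ← varSum_map, map_enumEmb,
          varSum_fracVar, ← PowerSeries.coeff_map, map_normPuncture, emb_comp_fracVar,
          ← normPuncture_map, map_enumEmb] at h
        exact h
      have hS : ∀ r, ∑ I : Finset (Fin (n + 2)),
            (if I ≠ ∅ ∧ I ≠ univ then
              (algebraMap (R (n+2)) (K (n+2)) (∑ i ∈ I, X i))^2 *
              (algebraMap (R (n+2)) (K (n+2)) (∑ i ∈ Iᶜ, X i))^2 *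
              ∑ r' ∈ Finset.range (r + 1),
                emb I (Gf fuel I.card r') * emb Iᶜ (Gf fuel Iᶜ.card (r - r'))
            else 0) = PowerSeries.coeff r
              ((normPuncture (fracVar (n + 2)) * normPuncture (fracVar (n + 2))) univ) := by
        intro r
        rw [SetFun.mul_apply, powerset_univ, map_sum]
        refine sum_congr rfl fun I _ => ?_
        rw [← compl_eq_univ_sdiff]
        split_ifs with h
        · have h1 := hsub I h.1 h.2
          have h2 := hsub Iᶜ (by simpa using h.2) (by simpa using h.1)
          rw [PowerSeries.coeff_mul, Finset.Nat.sum_antidiagonal_eq_sum_range_succ_mk, mul_sum]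
          refine sum_congr rfl fun r' _ => ?_
          rw [← h1, ← h2]; ring
        · by_cases h1 : I = ∅
          · rw [h1, normPuncture_empty, zero_mul, map_zero]
          · obtain rfl : I = univ := by
              by_contra h2
              exact h ⟨h1, h2⟩
            rw [compl_univ, normPuncture_empty, mul_zero, map_zero]
      rw [coeff_normPuncture (fracVar (n + 2)) (I := univ) (n := n) (by simp) g, Gf, mul_sum]
      refine sum_congr rfl fun s _ => ?_
      rw [hS, ← Dlt_eq, ← SX_eq]
      have hne := SX_ne_zero (n := n + 2) (by omega)
      push_cast
      field_simp

lemma SX_sq_mul_Fnpt {n : ℕ} (hn : n ≠ 0) (g : ℕ) :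
    SX n ^ 2 * Fnpt n g = PowerSeries.coeff g (twoPuncture (fracVar n) univ) := by
  rw [← expSeries_mul_normPuncture, PowerSeries.coeff_mul,
    Finset.Nat.sum_antidiagonal_eq_sum_range_succ_mk, Fnpt, mul_sum]
  refine sum_congr rfl fun d _ => ?_
  rw [← SX_sq_mul_Gf n n _ hn (by omega), coeff_expSeries, SX3_eq, Gnpt]
  have : algebraMap ℚ (K n) (1 / (d.factorial : ℚ)) = (1 / (d.factorial : ℚ) : K n) := by
    rw [map_div₀, map_one, map_natCast]; push_cast; rfl
  rw [this]; ring

/-- In the stable range, `F_g` is a polynomial, whose product with the square of the sum of the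
variables is given by `twoPuncture`. -/
lemma sq_mul_polyOf_Fnpt {n g : ℕ} (hn : n ≠ 0) (hg : 2 < 2 * g + n) :
    varSum (X : Fin n → R n) univ ^ 2 * polyOf (Fnpt n g)
      = PowerSeries.coeff g (twoPuncture (X : Fin n → R n) univ) := by
  obtain ⟨q, hq⟩ := (twoPuncture_spec (X : Fin n → R n)).exists_eq_sq_mul (I := univ) (g := g)
    (by simpa using hg)
  have hinj := IsFractionRing.injective (R n) (K n)
  have hF : algebraMap (R n) (K n) q = Fnpt n g := by
    apply mul_left_cancel₀ (pow_ne_zero 2 (SX_ne_zero hn))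
    rw [SX_sq_mul_Fnpt hn, SX_eq, show fracVar n = algebraMap (R n) (K n) ∘ X from rfl,
      ← map_twoPuncture, PowerSeries.coeff_map, hq, map_mul, map_pow, map_varSum]
  have hp : polyOf (Fnpt n g) = q := by
    have hex : ∃ p : R n, algebraMap (R n) (K n) p = Fnpt n g := ⟨q, hF⟩
    rw [polyOf, dif_pos hex]
    exact hinj (hex.choose_spec.trans hF.symm)
  rw [hp, hq]

lemma binomZ_zero (p : ℤ) : binomZ p 0 = 1 := by simp [binomZ]

lemma binomZ_succ_mul (p : ℤ) (k : ℕ) : (k + 1) * binomZ p (k + 1) = (p - k) * binomZ p k := by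
  rw [binomZ, binomZ, prod_range_succ, Nat.factorial_succ]
  have : (k.factorial : ℚ) ≠ 0 := by exact_mod_cast k.factorial_ne_zero
  push_cast
  field_simp

/-- Pascal's rule. -/
lemma binomZ_add_one_succ (p : ℤ) (k : ℕ) :
    binomZ (p + 1) (k + 1) = binomZ p (k + 1) + binomZ p k := by
  have h : ∀ k, binomZ (p + 1) (k + 1) * (k + 1) = (p + 1) * binomZ p k := by
    intro k
    rw [binomZ, binomZ, prod_range_succ', Nat.factorial_succ]
    have : (k.factorial : ℚ) ≠ 0 := by exact_mod_cast k.factorial_ne_zero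
    have e : ∀ i : ℕ, ((p + 1 : ℤ) : ℚ) - ((i + 1 : ℕ) : ℚ) = p - i := by
      intro i; push_cast; ring
    simp only [e]
    push_cast
    field_simp
    ring
  have hk : (k + 1 : ℚ) ≠ 0 := by exact_mod_cast k.succ_ne_zero
  apply mul_right_cancel₀ hk
  linear_combination h k - binomZ_succ_mul p k

section

variable {n : ℕ}

lemma yExpAdd_zero (c : R n) : yExpAdd c 0 = 1 := by
  have : (PowerSeries.mk fun k => MvPolynomial.C (binomZ 0 k) * c ^ k) = 1 := by
    ext1 k
    rw [PowerSeries.coeff_mk, PowerSeries.coeff_one]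
    cases k with
    | zero => simp [binomZ_zero]
    | succ k => simp [binomZ, prod_range_succ']
  rw [yExpAdd, this, (HahnSeries.ofPowerSeries ℤ (R n)).map_one, neg_zero, mul_one]; rfl

lemma yExpAdd_add_one (c : R n) (m : ℤ) :
    yExpAdd c (m + 1) = yExpAdd c m * (HahnSeries.single (-1 : ℤ) 1 + HahnSeries.C c) := by
  have h1 : (HahnSeries.single (-1 : ℤ) 1 + HahnSeries.C c : Lau n)
      = HahnSeries.single (-1 : ℤ) 1 *
        HahnSeries.ofPowerSeries ℤ (R n) (1 + PowerSeries.C c * PowerSeries.X) := by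
    rw [map_add, map_mul, (HahnSeries.ofPowerSeries ℤ (R n)).map_one, HahnSeries.ofPowerSeries_X,
      HahnSeries.ofPowerSeries_C, mul_add,
      mul_one, mul_left_comm, HahnSeries.single_mul_single]
    simp
  have h2 : (PowerSeries.mk fun k => MvPolynomial.C (binomZ (m + 1) k) * c ^ k)
      = (PowerSeries.mk fun k => MvPolynomial.C (binomZ m k) * c ^ k) *
        (1 + PowerSeries.C c * PowerSeries.X) := by
    ext1 k
    rw [mul_add, mul_one, ← mul_assoc, map_add]
    cases k with
    | zero => simp [binomZ_zero]
    | succ k =>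
      rw [PowerSeries.coeff_succ_mul_X, mul_comm _ (PowerSeries.C c), PowerSeries.coeff_C_mul]
      simp only [PowerSeries.coeff_mk]
      rw [binomZ_add_one_succ, map_add]; ring
  rw [h1, yExpAdd, yExpAdd, h2, map_mul, neg_add, ← one_mul (1 : R n),
    ← HahnSeries.single_mul_single, one_mul]
  ring

/-- `±y + c` as a Laurent series in `y⁻¹`. -/
def shiftedY (σ : Bool) (c : R n) : Lau n := yLau n σ + HahnSeries.C c

lemma LExp_zero (σ : Bool) (c : R n) : LExp σ c 0 = 1 := by
  rw [LExp, yExpAdd_zero]; simp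

lemma LExp_add_one (σ : Bool) (c : R n) (m : ℤ) :
    LExp σ c (m + 1) = LExp σ c m * shiftedY σ c := by
  rw [LExp, LExp, yExpAdd_add_one, shiftedY, yLau]
  cases σ with
  | true => simp
  | false =>
    have : (if Even (m + 1) then 1 else -1 : Lau n) = - if Even m then 1 else -1 := by
      by_cases h : Even m
      · rw [if_pos h, if_neg (by simpa [Int.even_add_one] using h)]
      · rw [if_neg h, if_pos (by simpa [Int.even_add_one] using h), neg_neg]
    simp only [Bool.false_eq_true, if_false, this, neg_mul, one_mul, map_neg]
    ring

/-- `±y + c` as a unit. -/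
def shiftedYUnit (σ : Bool) (c : R n) : (Lau n)ˣ where
  val := shiftedY σ c
  inv := LExp σ c (-1)
  val_inv := by rw [mul_comm, ← LExp_add_one, neg_add_cancel, LExp_zero]
  inv_val := by rw [← LExp_add_one, neg_add_cancel, LExp_zero]

lemma LExp_eq (σ : Bool) (c : R n) (m : ℤ) : LExp σ c m = ↑(shiftedYUnit σ c ^ m) := by
  have hu : ∀ m : ℤ, LExp σ c (m + 1) = LExp σ c m * ↑(shiftedYUnit σ c) := LExp_add_one σ c
  induction m using Int.induction_on with
  | zero => rw [LExp_zero, zpow_zero, Units.val_one]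
  | succ k ih => rw [hu, ih, zpow_add_one, Units.val_mul]
  | pred k ih =>
    have h := hu (-(k : ℤ) - 1)
    rw [sub_add_cancel, ih] at h
    rw [zpow_sub_one, Units.val_mul, h, Units.mul_inv_cancel_right]

lemma LExp_add (σ : Bool) (c : R n) (m m' : ℤ) :
    LExp σ c (m + m') = LExp σ c m * LExp σ c m' := by
  simp only [LExp_eq, zpow_add, Units.val_mul]

lemma LExp_one (σ : Bool) (c : R n) : LExp σ c 1 = shiftedY σ c := by
  rw [LExp_eq, zpow_one]; rfl

/-- The variables `±y, x_1, …, x_n` as Laurent series. -/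
def laurentVar (n : ℕ) (σ : Bool) : Option (Fin n) → Lau n :=
  fun o => o.elim (yLau n σ) (fun i => HahnSeries.C (X i))

lemma varSum_laurentVar (σ : Bool) (I : Finset (Fin n)) :
    varSum (laurentVar n σ) (insertNone I) = shiftedY σ (∑ i ∈ I, X i) := by
  rw [varSum, sum_insertNone, shiftedY, map_sum]; rfl

lemma coeff_twoPuncture_zero_pair {ι A : Type*} [DecidableEq ι] [CommRing A] [Algebra ℚ A]
    (x : ι → A) {i j : ι} (h : i ≠ j) :
    PowerSeries.coeff 0 (twoPuncture x {i, j}) = x i + x j := by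
  have hc := (twoPuncture_spec x).coeff_eqn {i, j} 0
  have hS : PowerSeries.coeff 0 ((twoPuncture x * twoPuncture x) {i, j}) = 2 := by
    rw [SetFun.mul_insert _ _ (by simpa using h), show ({j} : Finset ι) = insert j ∅ from rfl,
      sum_powerset_insert (notMem_empty j), powerset_empty, sum_singleton, sum_singleton]
    simp only [sdiff_self, sdiff_empty, bot_eq_empty, insert_empty_eq, twoPuncture_empty, mul_zero,
      zero_mul, zero_add, add_zero, map_add, PowerSeries.coeff_mul, Finset.Nat.antidiagonal_zero,
      sum_singleton, coeff_twoPuncture_zero_single]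
    norm_num
  rw [hS, card_pair h, if_pos rfl, varSum, sum_pair h] at hc
  refine natCast_mul_cancel (k := 12) (by norm_num) ?_
  push_cast at hc ⊢
  linear_combination hc

/-- The expansions of the functions `F_g(±y, x_I)` through `twoPuncture`. -/
lemma LExp_two_mul_FExp (σ : Bool) (g : ℕ) (I : Finset (Fin n)) :
    LExp σ (∑ i ∈ I, X i) 2 * FExp σ g I
      = PowerSeries.coeff g (twoPuncture (laurentVar n σ) (insertNone I)) := by
  rw [FExp]
  split_ifs with h0 h2
  · obtain ⟨rfl, hI⟩ := h0
    rw [card_eq_zero] at hI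
    subst hI
    rw [show insertNone (∅ : Finset (Fin n)) = {none} from rfl, coeff_twoPuncture_zero_single,
      show LExp σ (∑ i ∈ ∅, X i : R n) 2 = LExp σ _ (1 + 1) from rfl, LExp_add, LExp_one]
    rw [sum_empty, shiftedY, map_zero, add_zero, yLau]
    have hy : (HahnSeries.single (-1 : ℤ) 1 * HahnSeries.single (-1 : ℤ) 1 : Lau n) *
        HahnSeries.single (2 : ℤ) 1 = 1 := by
      rw [HahnSeries.single_mul_single, HahnSeries.single_mul_single]; simp
    cases σ
    · simp only [Bool.false_eq_true, if_false]; linear_combination hy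
    · simp only [if_true]; linear_combination hy
  · obtain ⟨rfl, hI⟩ := h2
    obtain ⟨i, rfl⟩ := card_eq_one.1 hI
    rw [← LExp_add, show (2 : ℤ) + -1 = 1 from rfl, LExp_one,
      show insertNone {i} = {none, some i} from by ext o; cases o <;> simp,
      coeff_twoPuncture_zero_pair _ (by simp), shiftedY, sum_singleton]
    rfl
  · let v : Fin (I.card + 1) → Lau n := Fin.cons (yLau n σ)
        (fun i : Fin I.card => HahnSeries.C (X ((I.orderIsoOfFin rfl) i : Fin n)))
    let ψ : R (I.card + 1) →+* Lau n :=
      eval₂Hom ((HahnSeries.C).comp (algebraMap ℚ (R n))) v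
    let e : Fin (I.card + 1) ↪ Option (Fin n) :=
      ⟨Fin.cons none (fun i => some (enumEmb I i)), by
        rw [Fin.cons_injective_iff]
        exact ⟨by simp, fun i j h => (enumEmb I).injective (Option.some_injective _ h)⟩⟩
    have hψ : ψ ∘ X = laurentVar n σ ∘ e := by
      funext i
      simp only [ψ, Function.comp_apply, eval₂Hom_X']
      refine Fin.cases ?_ (fun i => ?_) i
      · rfl
      · rfl
    have he : univ.map e = insertNone I := by
      ext o
      simp only [mem_map, mem_univ, true_and, Fin.exists_fin_succ]
      cases o with
      | none => simp [e]
      | some j =>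
        have hj := congrArg (fun s => j ∈ s) (map_enumEmb I)
        simp only [mem_map, mem_univ, true_and] at hj
        simp [e, hj]
    have h := congrArg ψ (sq_mul_polyOf_Fnpt (n := I.card + 1) (g := g) (by omega) (by omega))
    rw [map_mul, map_pow, map_varSum, hψ, ← varSum_map, he, varSum_laurentVar,
      ← PowerSeries.coeff_map, map_twoPuncture, hψ, ← twoPuncture_map, he] at h
    rw [← h, ← LExp_one, sq, ← LExp_add]
    rfl

end

section

variable {n : ℕ}

/-- The Laurent series `f` has `y`-degree at most `m`, with coefficient `c` at `y^m`. -/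
def HasTop (f : Lau n) (m : ℤ) (c : R n) : Prop :=
  ∃ q : PowerSeries (R n), f = HahnSeries.single (-m) 1 * HahnSeries.ofPowerSeries ℤ (R n) q ∧
    PowerSeries.constantCoeff q = c

namespace HasTop

variable {f f' : Lau n} {m m' : ℤ} {c c' : R n}

lemma coeff_eq (h : HasTop f m c) : f.coeff (-m) = c := by
  obtain ⟨q, rfl, rfl⟩ := h
  have := HahnSeries.coeff_single_mul_add (r := (1 : R n))
    (x := HahnSeries.ofPowerSeries ℤ (R n) q) (a := ((0 : ℕ) : ℤ)) (b := -m)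
  rw [Nat.cast_zero, zero_add, one_mul] at this
  rw [this]
  exact (HahnSeries.ofPowerSeries_apply_coeff (Γ := ℤ) q 0).trans
    (PowerSeries.coeff_zero_eq_constantCoeff_apply q)

lemma congr (h : HasTop f m c) (hm : m = m') (hc : c = c') : HasTop f m' c' := hm ▸ hc ▸ h

lemma mul (h : HasTop f m c) (h' : HasTop f' m' c') : HasTop (f * f') (m + m') (c * c') := by
  obtain ⟨q, rfl, rfl⟩ := h
  obtain ⟨q', rfl, rfl⟩ := h'
  refine ⟨q * q', ?_, map_mul _ _ _⟩
  rw [map_mul, neg_add, ← one_mul (1 : R n), ← HahnSeries.single_mul_single, one_mul]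
  ring

lemma add (h : HasTop f m c) (h' : HasTop f' m c') : HasTop (f + f') m (c + c') := by
  obtain ⟨q, rfl, rfl⟩ := h
  obtain ⟨q', rfl, rfl⟩ := h'
  exact ⟨q + q', by rw [map_add, mul_add], map_add _ _ _⟩

lemma zero (m : ℤ) : HasTop (0 : Lau n) m 0 :=
  ⟨0, by rw [map_zero, mul_zero], map_zero _⟩

lemma sum {κ : Type*} (s : Finset κ) {F : κ → Lau n} {G : κ → R n}
    (h : ∀ i ∈ s, HasTop (F i) m (G i)) : HasTop (∑ i ∈ s, F i) m (∑ i ∈ s, G i) := by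
  classical
  induction s using Finset.induction_on with
  | empty => exact zero m
  | insert i s hi ih =>
    rw [sum_insert hi, sum_insert hi]
    exact (h i (mem_insert_self i s)).add (ih fun j hj => h j (mem_insert_of_mem hj))

lemma const (c : R n) : HasTop (HahnSeries.C c : Lau n) 0 c :=
  ⟨PowerSeries.C c, by rw [HahnSeries.ofPowerSeries_C, neg_zero]; exact (one_mul _).symm, by simp⟩

lemma const_mul (a : R n) (h : HasTop f m c) : HasTop (HahnSeries.C a * f) m (a * c) :=
  ((const a).mul h).congr (zero_add m) rfl

lemma neg (h : HasTop f m c) : HasTop (-f) m (-c) := by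
  obtain ⟨q, rfl, rfl⟩ := h
  exact ⟨-q, by rw [map_neg]; ring, map_neg _ _⟩

lemma sub (h : HasTop f m c) (h' : HasTop f' m c') : HasTop (f - f') m (c - c') := by
  rw [sub_eq_add_neg, sub_eq_add_neg]; exact h.add h'.neg

lemma of_lt (h : HasTop f m c) (hm : m < m') : HasTop f m' 0 := by
  obtain ⟨k, hk⟩ : ∃ k : ℕ, m' - m = (k + 1 : ℕ) := ⟨(m' - m - 1).toNat, by omega⟩
  have h1 : HasTop (1 : Lau n) (m' - m) 0 := by
    refine ⟨PowerSeries.X ^ (k + 1), ?_, by simp⟩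
    rw [hk, map_pow, HahnSeries.ofPowerSeries_X, HahnSeries.single_pow,
      HahnSeries.single_mul_single]
    simp
  have := h.mul h1
  rw [mul_one, mul_zero] at this
  exact this.congr (by ring) rfl

lemma of_natCast_mul {k : ℕ} (hk : k ≠ 0) (h : HasTop ((k : Lau n) * f) m c) :
    HasTop f m (MvPolynomial.C (1 / (k : ℚ)) * c) := by
  have h1 := h.const_mul (MvPolynomial.C (1 / (k : ℚ)))
  rwa [← mul_assoc, ← map_natCast (HahnSeries.C : R n →+* Lau n) k, ← map_mul,
    ← map_natCast (MvPolynomial.C : ℚ →+* R n) k, ← map_mul,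
    one_div_mul_cancel (by exact_mod_cast hk), map_one, map_one, one_mul] at h1

lemma exists_of (f : Lau n) : ∃ m, ∃ c, HasTop f m c :=
  ⟨-f.order, _, LaurentSeries.powerSeriesPart f, by
    rw [neg_neg]; exact (LaurentSeries.single_order_mul_powerSeriesPart f).symm, rfl⟩

end HasTop

lemma hasTop_LExp (σ : Bool) (c : R n) (m : ℤ) :
    HasTop (LExp σ c m) m (if σ then 1 else if Even m then 1 else -1) := by
  have h : HasTop (yExpAdd ((if σ then 1 else -1 : R n) * c) m) m 1 :=
    ⟨_, rfl, by rw [← PowerSeries.coeff_zero_eq_constantCoeff_apply]; simp [binomZ_zero]⟩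
  have := h.const_mul (if σ then 1 else if Even m then 1 else -1)
  rw [mul_one] at this
  rw [LExp]
  convert this using 2
  split_ifs <;> simp

/-- Truncated binomial expansion of `(u + v)^m` for large `u = ±y + c`. -/
lemma HasTop.binomial_remainder (σ : Bool) (c v : R n) (N : ℕ) (m : ℤ) :
    ∃ t, HasTop (LExp σ (c + v) m - ∑ k ∈ range (N + 1),
      HahnSeries.C (MvPolynomial.C (binomZ m k) * v ^ k) *
        LExp σ c (m - k)) (m - N - 1) t := by
  set u := shiftedY σ c with hu
  set w := shiftedY σ (c + v) with hw
  have hwu : w = u + HahnSeries.C v := by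
    simp only [hw, hu, shiftedY, map_add]; ring
  set E : ℤ → Lau n := fun m => LExp σ (c + v) m - ∑ k ∈ range (N + 1),
      HahnSeries.C (MvPolynomial.C (binomZ m k) * v ^ k) * LExp σ c (m - k)
    with hE
  have step : ∀ m, E (m + 1) = w * E m + HahnSeries.C (MvPolynomial.C (binomZ m N) * v ^ (N + 1)) *
      LExp σ c (m - N) := by
    intro m
    have hsum : ∀ N : ℕ, w * ∑ k ∈ range (N + 1),
        HahnSeries.C (MvPolynomial.C (binomZ m k) * v ^ k) * LExp σ c (m - k)
        = (∑ k ∈ range (N + 1), HahnSeries.C (MvPolynomial.C (binomZ (m + 1) k) * v ^ k) *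
          LExp σ c (m + 1 - k)) +
          HahnSeries.C (MvPolynomial.C (binomZ m N) * v ^ (N + 1)) *
            LExp σ c (m - N) := by
      have hz : ∀ l : ℤ, LExp σ c (l + 1) = u * LExp σ c l := by
        intro l; rw [LExp_add_one, mul_comm]
      intro N
      induction N with
      | zero =>
        simp only [zero_add, sum_range_one, binomZ_zero, Nat.cast_zero, sub_zero, hz, hwu]
        simp only [map_one, pow_zero, pow_one, one_mul]; ring
      | succ N ih =>
        rw [sum_range_succ, mul_add, ih, sum_range_succ _ (N + 1)]
        have e1 : m + 1 - ((N + 1 : ℕ) : ℤ) = m - (N + 1 : ℕ) + 1 := by ring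
        have e2 : m - (N : ℤ) = m - (N + 1 : ℕ) + 1 := by push_cast; ring
        rw [e1, e2, hz, binomZ_add_one_succ, hwu]
        simp only [map_add, map_mul, map_pow]
        ring
    simp only [hE, mul_sub, hsum]
    rw [LExp_add_one]; ring
  have hr : ∀ m : ℤ, ∃ t, HasTop (HahnSeries.C (MvPolynomial.C (binomZ m N) * v ^ (N + 1)) *
      LExp σ c (m - N)) (m + 1 - N - 1) t := fun m =>
    ⟨_, ((hasTop_LExp σ c (m - N)).const_mul _).congr (by ring) rfl⟩
  change ∃ t, HasTop (E m) (m - N - 1) t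
  induction m using Int.induction_on with
  | zero =>
    have : E 0 = 0 := by
      simp only [hE]
      rw [sum_range_succ']
      simp [binomZ, prod_range_succ', LExp_zero]
    rw [this]
    exact ⟨0, HasTop.zero _⟩
  | succ k ih =>
    obtain ⟨t, ht⟩ := ih
    obtain ⟨t', ht'⟩ := hr k
    have h1 := hasTop_LExp σ (c + v) 1
    rw [LExp_one] at h1
    rw [step]
    exact ⟨_, ((h1.mul ht).congr (by ring) rfl).add ht'⟩
  | pred k ih =>
    obtain ⟨t, ht⟩ := ih
    obtain ⟨t', ht'⟩ := hr (-(k : ℤ) - 1)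
    have h1 := hasTop_LExp σ (c + v) (-1)
    have h2 := step (-(k : ℤ) - 1)
    rw [sub_add_cancel] at h2 ht'
    have h3 : E (-(k : ℤ) - 1) = LExp σ (c + v) (-1 : ℤ) * (E (-(k : ℤ)) -
        HahnSeries.C (MvPolynomial.C (binomZ (-(k : ℤ) - 1) N) * v ^ (N + 1)) *
      LExp σ c (-(k : ℤ) - 1 - N)) := by
      rw [h2, add_sub_cancel_right, hw, ← LExp_one, ← mul_assoc, ← LExp_add,
        show (-1 : ℤ) + 1 = 0 from rfl, LExp_zero, one_mul]
    rw [h3]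
    exact ⟨_, (h1.mul (ht.sub ht')).congr (by ring) rfl⟩

/-- First order effect of a shift of the base points on a sum of powers. -/
lemma HasTop.sum_shift (σ : Bool) {κ : Type*} (s : Finset κ) (w : κ → Lau n) (c : κ → R n)
    (v : R n) (e m : ℤ)
    (h : ∀ m : ℤ, ∃ t, HasTop (∑ J ∈ s, LExp σ (c J) m * w J)
      (e + m) t) :
    ∃ t, HasTop (∑ J ∈ s, LExp σ (c J + v) m * w J
      - ∑ J ∈ s, LExp σ (c J) m * w J
      - HahnSeries.C (m * v) * ∑ J ∈ s,
        LExp σ (c J) (m - 1) * w J) (e + m - 2) t := by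
  have mono : ∀ {f : Lau n} {l l' : ℤ}, l ≤ l' → (∃ t, HasTop f l t) → ∃ t, HasTop f l' t := by
    rintro f l l' hl ⟨t, ht⟩
    rcases hl.eq_or_lt with rfl | hl
    · exact ⟨t, ht⟩
    · exact ⟨0, ht.of_lt hl⟩
  obtain ⟨D, hD⟩ : ∃ D : ℕ, ∀ J ∈ s, ∃ t, HasTop (w J) (D + e) t := by
    choose b hb using fun J => HasTop.exists_of (w J)
    refine ⟨∑ J ∈ s, (b J - e).toNat, fun J hJ => mono ?_ (hb J)⟩
    have := single_le_sum (f := fun J => (b J - e).toNat) (fun _ _ => Nat.zero_le _) hJ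
    omega
  have hrem := fun J : κ => HasTop.binomial_remainder σ (c J) v (D + 1) m
  choose t ht using hrem
  have key : ∑ J ∈ s, LExp σ (c J + v) m * w J
      - ∑ J ∈ s, LExp σ (c J) m * w J
      - HahnSeries.C (m * v) * ∑ J ∈ s,
        LExp σ (c J) (m - 1) * w J
      = ∑ J ∈ s, (LExp σ (c J + v) m - ∑ k ∈ range (D + 1 + 1),
        HahnSeries.C (MvPolynomial.C (binomZ m k) * v ^ k) *
          LExp σ (c J) (m - k)) * w J
        + ∑ k ∈ range D, HahnSeries.C (MvPolynomial.C (binomZ m (k + 2)) * v ^ (k + 2)) *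
          ∑ J ∈ s, LExp σ (c J) (m - (k + 2 : ℕ)) * w J := by
    have h1 : binomZ m 1 = m := by simp [binomZ]
    have h0 : ∑ J ∈ s, (∑ k ∈ range (D + 1 + 1),
        HahnSeries.C (MvPolynomial.C (binomZ m k) * v ^ k) *
          LExp σ (c J) (m - k)) * w J
        = ∑ k ∈ range (D + 1 + 1), HahnSeries.C (MvPolynomial.C (binomZ m k) * v ^ k) *
          ∑ J ∈ s, LExp σ (c J) (m - k) * w J := by
      simp only [sum_mul, mul_sum]
      rw [sum_comm]
      simp only [mul_assoc]
    simp only [sub_mul, sum_sub_distrib]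
    rw [h0, sum_range_succ', sum_range_succ']
    have h2 : (MvPolynomial.C (m : ℚ) : R n) = m := map_intCast _ m
    simp only [zero_add, h1, h2, pow_one, binomZ_zero, map_one, pow_zero, one_mul, Nat.cast_zero,
      sub_zero, Nat.cast_one]
    ring
  rw [key]
  have hA : ∃ t, HasTop (∑ J ∈ s,
      (LExp σ (c J + v) m - ∑ k ∈ range (D + 1 + 1),
        HahnSeries.C (MvPolynomial.C (binomZ m k) * v ^ k) *
          LExp σ (c J) (m - k)) * w J) (e + m - 2) t := by
    have hD' : ∀ J, ∃ t, J ∈ s → HasTop (w J) (D + e) t := fun J => by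
      by_cases hJ : J ∈ s
      · exact (hD J hJ).imp fun _ h _ => h
      · exact ⟨0, fun h => absurd h hJ⟩
    choose t' ht' using hD'
    exact ⟨_, HasTop.sum s fun J hJ => ((ht J).mul (ht' J hJ)).congr (by push_cast; ring) rfl⟩
  have hB : ∃ t, HasTop (∑ k ∈ range D,
      HahnSeries.C (MvPolynomial.C (binomZ m (k + 2)) * v ^ (k + 2)) *
          ∑ J ∈ s, LExp σ (c J) (m - (k + 2 : ℕ)) * w J)
      (e + m - 2) t := by
    have : ∀ k : ℕ, ∃ t, HasTop (HahnSeries.C (MvPolynomial.C (binomZ m (k + 2)) * v ^ (k + 2)) *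
          ∑ J ∈ s, LExp σ (c J) (m - (k + 2 : ℕ)) * w J)
          (e + m - 2) t := by
      intro k
      obtain ⟨t, ht⟩ := h (m - (k + 2 : ℕ))
      exact mono (by push_cast; omega) ⟨_, ht.const_mul _⟩
    choose t' ht' using this
    exact ⟨_, HasTop.sum _ fun k _ => ht' k⟩
  obtain ⟨_, hA⟩ := hA
  obtain ⟨_, hB⟩ := hB
  exact ⟨_, hA.add hB⟩

end

section

variable {n : ℕ}

/-- The functions `(±y + Σ_{i ∈ I} x_i)^2 F_g(±y, x_I)`. -/
def yPuncture (n : ℕ) (σ : Bool) : SetFun (Fin n) (PowerSeries (Lau n)) :=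
  ⟨fun I => twoPuncture (laurentVar n σ) (insertNone I)⟩

/-- The functions `(Σ_{i ∈ I} x_i)^2 F_g(x_I)`, as constant Laurent series. -/
def constPuncture (n : ℕ) : SetFun (Fin n) (PowerSeries (Lau n)) :=
  ⟨fun I => PowerSeries.map HahnSeries.C (twoPuncture (X : Fin n → R n) I)⟩

lemma yPuncture_apply (σ : Bool) (I : Finset (Fin n)) :
    yPuncture n σ I = twoPuncture (laurentVar n σ) (insertNone I) := rfl

lemma insertNone_eq (I : Finset (Fin n)) :
    insertNone I = insert none (I.map Function.Embedding.some) := by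
  ext o; cases o <;> simp

lemma constPuncture_apply (σ : Bool) (I : Finset (Fin n)) :
    constPuncture n I = twoPuncture (laurentVar n σ) (I.map Function.Embedding.some) := by
  rw [twoPuncture_map]
  exact map_twoPuncture _ _ _

lemma yPuncture_eqn (σ : Bool) (I : Finset (Fin n)) :
    12 * (genusDer (Lau n) (yPuncture n σ I) + (I.card : PowerSeries (Lau n)) * yPuncture n σ I)
      = PowerSeries.X * PowerSeries.C (LExp σ (varSum X I) 3) * yPuncture n σ I
        + 12 * PowerSeries.C (LExp σ (varSum X I) 1) * (constPuncture n * yPuncture n σ) I := by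
  have h := (twoPuncture_spec (laurentVar n σ)).eqn (insertNone I)
  have hS : (twoPuncture (laurentVar n σ) * twoPuncture (laurentVar n σ)) (insertNone I)
      = 2 * (constPuncture n * yPuncture n σ) I := by
    rw [insertNone_eq, SetFun.mul_insert _ _ (by simp)]
    have hm : ∀ F : Finset (Option (Fin n)) → PowerSeries (Lau n),
        ∑ J ∈ (I.map Function.Embedding.some).powerset, F J
          = ∑ J ∈ I.powerset, F (J.map Function.Embedding.some) := by
      intro F
      refine (sum_bij (fun J _ => J.map Function.Embedding.some) ?_ ?_ ?_ ?_).symm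
      · intro J hJ
        exact mem_powerset.2 (map_subset_map.2 (mem_powerset.1 hJ))
      · intro J _ J' _ hh; exact map_injective _ hh
      · intro J hJ
        obtain ⟨J', hJ', rfl⟩ := (subset_map_iff.1 (mem_powerset.1 hJ))
        exact ⟨J', mem_powerset.2 hJ', rfl⟩
      · intro J _; rfl
    rw [hm]
    simp only [← Finset.map_sdiff, ← insertNone_eq, ← constPuncture_apply, ← yPuncture_apply]
    have hc : ∀ J, yPuncture n σ J * constPuncture n (I \ J)
        = constPuncture n (I \ J) * yPuncture n σ J := fun J => mul_comm _ _
    simp only [hc]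
    rw [sum_add_distrib, two_mul, SetFun.mul_apply,
      ← SetFun.sum_powerset_sdiff_swap I (fun J J' => constPuncture n J * yPuncture n σ J')]
  have hv : varSum (laurentVar n σ) (insertNone I) = LExp σ (varSum X I) 1 := by
    rw [varSum_laurentVar, LExp_one]; rfl
  have h3 : LExp σ (varSum X I : R n) 3 = LExp σ (varSum X I) 1 ^ 3 := by
    rw [pow_three, ← LExp_add, ← LExp_add]; rfl
  rw [hS, hv, card_insertNone, ← yPuncture_apply] at h
  rw [h3, map_pow]
  push_cast at h
  linear_combination h

/-- The functions `(±y + Σ_{i ∈ I} x_i)^(m + 2) F_g(±y, x_I)`. -/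
def yWeighted (n : ℕ) (σ : Bool) (m : ℤ) : SetFun (Fin n) (PowerSeries (Lau n)) :=
  ⟨fun I => PowerSeries.C (LExp σ (varSum X I) m) * yPuncture n σ I⟩

lemma yWeighted_apply (σ : Bool) (m : ℤ) (I : Finset (Fin n)) :
    yWeighted n σ m I = PowerSeries.C (LExp σ (varSum X I) m) * yPuncture n σ I := rfl

lemma yWeighted_eqn (σ : Bool) (m : ℤ) (I : Finset (Fin n)) :
    12 * (genusDer (Lau n) (yWeighted n σ m I) +
        (I.card : PowerSeries (Lau n)) * yWeighted n σ m I)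
      = PowerSeries.X * yWeighted n σ (m + 3) I
        + 12 * ∑ K ∈ I.powerset, constPuncture n K *
          (PowerSeries.C (LExp σ (varSum X (I \ K) + varSum X K) (m + 1)) *
            yPuncture n σ (I \ K)) := by
  have hs : ∑ K ∈ I.powerset, constPuncture n K *
          (PowerSeries.C (LExp σ (varSum X (I \ K) + varSum X K) (m + 1)) *
            yPuncture n σ (I \ K))
      = PowerSeries.C (LExp σ (varSum X I) m) * PowerSeries.C (LExp σ (varSum X I) 1) *
        (constPuncture n * yPuncture n σ) I := by
    rw [SetFun.mul_apply, mul_sum]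
    refine sum_congr rfl fun K hK => ?_
    rw [add_comm (varSum X (I \ K)), varSum_add_sdiff _ hK, LExp_add, map_mul]
    ring
  rw [hs, yWeighted_apply, yWeighted_apply, genusDer_C_mul, LExp_add, map_mul]
  linear_combination PowerSeries.C (LExp σ (varSum X I) m) * yPuncture_eqn σ I

/-- The generating function of `L_g^{a + 2, b + 2}(y, x_N)`. -/
def yPairing (n : ℕ) (a b : ℤ) : SetFun (Fin n) (PowerSeries (Lau n)) :=
  yWeighted n true a * yWeighted n false b

/-- The effect on `yPairing` of merging the variables in `K` with `±y`. -/
def yBracket (a b : ℤ) (K N : Finset (Fin n)) : PowerSeries (Lau n) :=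
  ∑ L ∈ N.powerset,
    (PowerSeries.C (LExp true (varSum X L + varSum X K) (a + 1)) * yPuncture n true L *
        yWeighted n false b (N \ L)
      + PowerSeries.C (LExp false (varSum X (N \ L) + varSum X K) (b + 1)) *
        yPuncture n false (N \ L) * yWeighted n true a L)

lemma LExp_true_add_LExp_false (p q : R n) :
    LExp true p 1 + LExp false q 1 = HahnSeries.C (p + q) := by
  rw [LExp_one, LExp_one, shiftedY, shiftedY, map_add, yLau, yLau]
  simp only [if_true, Bool.false_eq_true, if_false]
  ring

lemma yPairing_add_one (a b : ℤ) (N : Finset (Fin n)) :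
    yPairing n (a + 1) b N + yPairing n a (b + 1) N
      = PowerSeries.C (HahnSeries.C (varSum X N)) * yPairing n a b N := by
  simp only [yPairing, SetFun.mul_apply, ← sum_add_distrib, mul_sum]
  refine sum_congr rfl fun J hJ => ?_
  rw [← varSum_add_sdiff _ hJ, ← LExp_true_add_LExp_false]
  simp only [yWeighted_apply, LExp_add, map_mul, map_add]
  ring

lemma yPairing_eqn (a b : ℤ) (N : Finset (Fin n)) :
    12 * (genusDer (Lau n) (yPairing n a b N) + (N.card : PowerSeries (Lau n)) * yPairing n a b N)
      = PowerSeries.X * (PowerSeries.C (HahnSeries.C (varSum X N ^ 3)) * yPairing n a b N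
          - PowerSeries.C (HahnSeries.C (3 * varSum X N)) * yPairing n (a + 1) (b + 1) N)
        + 12 * ∑ K ∈ N.powerset, constPuncture n K * yBracket a b K (N \ K) := by
  have h1 : 12 * (genusDer (Lau n) (yPairing n a b N) +
        (N.card : PowerSeries (Lau n)) * yPairing n a b N)
      = ∑ J ∈ N.powerset, ((12 * (genusDer (Lau n) (yWeighted n true a J) +
            (J.card : PowerSeries (Lau n)) * yWeighted n true a J)) * yWeighted n false b (N \ J)
          + yWeighted n true a J * (12 * (genusDer (Lau n) (yWeighted n false b (N \ J)) +
            ((N \ J).card : PowerSeries (Lau n)) * yWeighted n false b (N \ J)))) := by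
    simp only [yPairing, SetFun.mul_apply, map_sum, mul_sum, ← sum_add_distrib]
    refine sum_congr rfl fun J hJ => ?_
    rw [genusDer_mul, ← card_add_card_sdiff' hJ]
    push_cast
    ring
  have h2 : ∑ J ∈ N.powerset, (yWeighted n true (a + 3) J * yWeighted n false b (N \ J)
      + yWeighted n true a J * yWeighted n false (b + 3) (N \ J))
      = PowerSeries.C (HahnSeries.C (varSum X N ^ 3)) * yPairing n a b N
          - PowerSeries.C (HahnSeries.C (3 * varSum X N)) * yPairing n (a + 1) (b + 1) N := by
    simp only [yPairing, SetFun.mul_apply, mul_sum, ← sum_sub_distrib]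
    refine sum_congr rfl fun J hJ => ?_
    have h3 : ∀ (σ : Bool) (c : R n) (m : ℤ), LExp σ c (m + 3) = LExp σ c m * LExp σ c 1 ^ 3 := by
      intro σ c m
      rw [pow_three, ← LExp_add, ← LExp_add, ← LExp_add]; rfl
    rw [← varSum_add_sdiff _ hJ, map_mul HahnSeries.C, map_pow HahnSeries.C,
      ← LExp_true_add_LExp_false, map_ofNat]
    simp only [yWeighted_apply, h3, LExp_add _ _ _ 1, map_mul, map_add, map_pow, map_ofNat]
    ring
  have h4 : ∑ J ∈ N.powerset, ((∑ K ∈ J.powerset, constPuncture n K *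
          (PowerSeries.C (LExp true (varSum X (J \ K) + varSum X K) (a + 1)) *
            yPuncture n true (J \ K))) * yWeighted n false b (N \ J))
      = ∑ K ∈ N.powerset, ∑ L ∈ (N \ K).powerset, constPuncture n K *
        (PowerSeries.C (LExp true (varSum X L + varSum X K) (a + 1)) * yPuncture n true L *
        yWeighted n false b ((N \ K) \ L)) := by
    rw [← SetFun.sum_powerset_powerset N (fun K L J => constPuncture n K *
        (PowerSeries.C (LExp true (varSum X L + varSum X K) (a + 1)) * yPuncture n true L *
        yWeighted n false b J))]
    refine sum_congr rfl fun J _ => ?_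
    rw [sum_mul]
    exact sum_congr rfl fun K _ => by ring
  have h5 : ∑ J ∈ N.powerset, (yWeighted n true a J * (∑ K ∈ (N \ J).powerset, constPuncture n K *
          (PowerSeries.C (LExp false (varSum X ((N \ J) \ K) + varSum X K) (b + 1)) *
            yPuncture n false ((N \ J) \ K))))
      = ∑ K ∈ N.powerset, ∑ L ∈ (N \ K).powerset, constPuncture n K *
        (PowerSeries.C (LExp false (varSum X ((N \ K) \ L) + varSum X K) (b + 1)) *
          yPuncture n false ((N \ K) \ L) * yWeighted n true a L) := by
    rw [SetFun.sum_powerset_sdiff_swap N (fun J J' => yWeighted n true a J *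
      (∑ K ∈ J'.powerset, constPuncture n K *
          (PowerSeries.C (LExp false (varSum X (J' \ K) + varSum X K) (b + 1)) *
            yPuncture n false (J' \ K))))]
    have hswap : ∀ K, ∑ L ∈ (N \ K).powerset, constPuncture n K *
        (PowerSeries.C (LExp false (varSum X ((N \ K) \ L) + varSum X K) (b + 1)) *
          yPuncture n false ((N \ K) \ L) * yWeighted n true a L)
        = ∑ L ∈ (N \ K).powerset, constPuncture n K *
        (PowerSeries.C (LExp false (varSum X L + varSum X K) (b + 1)) *
          yPuncture n false L * yWeighted n true a ((N \ K) \ L)) := fun K =>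
      (SetFun.sum_powerset_sdiff_swap (N \ K) (fun L L' => constPuncture n K *
        (PowerSeries.C (LExp false (varSum X L + varSum X K) (b + 1)) *
          yPuncture n false L * yWeighted n true a L'))).symm
    simp only [hswap]
    rw [← SetFun.sum_powerset_powerset N (fun K L J => constPuncture n K *
        (PowerSeries.C (LExp false (varSum X L + varSum X K) (b + 1)) *
          yPuncture n false L * yWeighted n true a J))]
    refine sum_congr rfl fun J _ => ?_
    rw [mul_sum]
    exact sum_congr rfl fun K _ => by ring
  have h6 : ∑ K ∈ N.powerset, constPuncture n K * yBracket a b K (N \ K)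
      = ∑ K ∈ N.powerset, ∑ L ∈ (N \ K).powerset, constPuncture n K *
          (PowerSeries.C (LExp true (varSum X L + varSum X K) (a + 1)) * yPuncture n true L *
          yWeighted n false b ((N \ K) \ L))
        + ∑ K ∈ N.powerset, ∑ L ∈ (N \ K).powerset, constPuncture n K *
          (PowerSeries.C (LExp false (varSum X ((N \ K) \ L) + varSum X K) (b + 1)) *
          yPuncture n false ((N \ K) \ L) * yWeighted n true a L) := by
    rw [← sum_add_distrib]
    refine sum_congr rfl fun K _ => ?_
    rw [← sum_add_distrib, yBracket, mul_sum]
    exact sum_congr rfl fun L _ => mul_add _ _ _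
  rw [h6, ← h4, ← h5, h1, ← h2, ← sum_add_distrib, mul_sum, mul_sum, ← sum_add_distrib]
  refine sum_congr rfl fun J _ => ?_
  rw [yWeighted_eqn, yWeighted_eqn]
  ring

end

lemma SetFun.sq_insert {ι B : Type*} [DecidableEq ι] [CommRing B] (f : SetFun ι B) {I : Finset ι}
    {j : ι} (hj : j ∉ I) :
    (f * f) (insert j I) = 2 * ∑ J ∈ I.powerset, f (insert j J) * f (I \ J) := by
  rw [SetFun.mul_insert _ _ hj, sum_add_distrib, two_mul,
    SetFun.sum_powerset_sdiff_swap I (fun J J' => f J * f (insert j J'))]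
  simp only [mul_comm (f (I \ _))]

section

variable {ι A : Type*} [DecidableEq ι] [CommRing A] [Algebra ℚ A]

/-- The functions `(Σ_{i ∈ I} x_i)^2 F_0(x_I)`. -/
def genusZero (x : ι → A) : SetFun ι A := ⟨fun I => PowerSeries.coeff 0 (twoPuncture x I)⟩

lemma genusZero_empty (x : ι → A) : genusZero x ∅ = 0 := by
  change PowerSeries.coeff 0 (twoPuncture x ∅) = 0
  rw [twoPuncture_empty, map_zero]

lemma genusZero_singleton (x : ι → A) (i : ι) : genusZero x {i} = 1 :=
  coeff_twoPuncture_zero_single x i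

lemma genusZero_eqn (x : ι → A) (I : Finset ι) :
    2 * ((I.card : A) - 1) * genusZero x I = varSum x I * (genusZero x * genusZero x) I := by
  have h := (twoPuncture_spec x).coeff_eqn I 0
  rw [if_pos rfl, mul_zero, zero_add] at h
  have h2 : PowerSeries.coeff 0 ((twoPuncture x * twoPuncture x) I)
      = (genusZero x * genusZero x) I := by
    rw [SetFun.mul_apply, SetFun.mul_apply, map_sum]
    refine sum_congr rfl fun J _ => ?_
    rw [PowerSeries.coeff_mul, Finset.Nat.antidiagonal_zero, sum_singleton]; rfl
  rw [h2] at h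
  refine natCast_mul_cancel (k := 6) (by norm_num) ?_
  push_cast at h ⊢
  change _ * genusZero x I = _ at h
  linear_combination h

/-- The behaviour of the genus zero functions to first order in one of the variables. -/
lemma genusZero_insert (x : ι → A) {j : ι} (he : x j ^ 2 = 0) (I : Finset ι) (hj : j ∉ I) :
    genusZero x (insert j I)
      = (if I = ∅ then 1 else 0) + (varSum x I + I.card * x j) * genusZero x I := by
  induction hk : I.card using Nat.strong_induction_on generalizing I with
  | _ k ih =>
    rcases I.eq_empty_or_nonempty with rfl | hne
    · rw [insert_empty_eq, genusZero_singleton, genusZero_empty, if_pos rfl, mul_zero, add_zero]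
    rw [if_neg hne.ne_empty, zero_add]
    have hS : (genusZero x * genusZero x) (insert j I) = 2 * genusZero x I
        + (varSum x I + I.card * x j) * (genusZero x * genusZero x) I := by
      have h1 : ∀ J ∈ I.powerset, genusZero x (insert j J) * genusZero x (I \ J)
          = (if J = ∅ then 1 else 0) * genusZero x (I \ J)
            + (varSum x J + J.card * x j) * (genusZero x J * genusZero x (I \ J)) := by
        intro J hJ
        rw [mem_powerset] at hJ
        rcases hJ.eq_or_ssubset with rfl | hss
        · rw [sdiff_self, bot_eq_empty, genusZero_empty]; ring
        · rw [ih J.card (hk ▸ card_lt_card hss) J (fun h => hj (hJ h)) rfl]; ring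
      have h2 : ∑ J ∈ I.powerset, (if J = ∅ then 1 else 0) * genusZero x (I \ J)
          = genusZero x I := by
        simp [ite_mul, sum_ite_eq']
      have h3 : ∀ v : Finset ι → A, (∀ J ∈ I.powerset, v J + v (I \ J) = v I) →
          2 * ∑ J ∈ I.powerset, v J * (genusZero x J * genusZero x (I \ J))
            = v I * (genusZero x * genusZero x) I := by
        intro v hv
        rw [two_mul]
        nth_rw 2 [SetFun.sum_powerset_sdiff_swap I
          (fun J J' => v J * (genusZero x J * genusZero x J'))]
        rw [← sum_add_distrib, SetFun.mul_apply, mul_sum]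
        refine sum_congr rfl fun J hJ => ?_
        rw [← hv J hJ]; ring
      rw [SetFun.sq_insert _ hj, sum_congr rfl h1, sum_add_distrib, h2, mul_add,
        h3 (fun J => varSum x J + J.card * x j)]
      intro J hJ
      rw [← varSum_add_sdiff x hJ, ← card_add_card_sdiff' hJ]
      push_cast; ring
    have h1 := genusZero_eqn x (insert j I)
    rw [hS, varSum_insert _ hj, card_insert_of_notMem hj] at h1
    have h2 := genusZero_eqn x I
    refine natCast_mul_cancel (k := 2 * I.card) (by have := card_pos.2 hne; omega) ?_
    rw [← hk]
    push_cast at h1 ⊢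
    linear_combination h1 - (varSum x I + (I.card + 1) * x j) * h2
      + I.card * (genusZero x * genusZero x) I * he

/-- The behaviour of solutions of the recursion for `topCoeff` to first order in one of the
variables. -/
lemma insert_of_topCoeff_eqn (x : ι → A) {T : ℕ → ℤ → ℤ → Finset ι → A}
    (hT : ∀ (g : ℕ) (a b : ℤ) (N : Finset ι), 12 * (2 * g + N.card) * T g a b N
      = (if g = 0 then 0 else -(3 * varSum x N * T (g - 1) (a + 1) (b + 1) N))
        + 12 * ∑ K ∈ N.powerset, genusZero x K *
          ((varSum x (N \ K) + ((a + b + 2 : ℤ) : A) * varSum x K) * T g a b (N \ K)))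
    {j : ι} (he : x j ^ 2 = 0) (g : ℕ) (a b : ℤ) (N : Finset ι) (hj : j ∉ N) :
    T g a b (insert j N)
      = (varSum x N + ((2 * g + N.card + a + b + 2 : ℤ) : A) * x j) * T g a b N := by
  induction hk : g + N.card using Nat.strong_induction_on generalizing g a b N with
  | _ k ih =>
    set Q := ∑ K ∈ N.powerset, genusZero x K *
          ((varSum x (N \ K) + ((a + b + 2 : ℤ) : A) * varSum x K) * T g a b (N \ K)) with hQ
    have hS : ∑ K ∈ (insert j N).powerset, genusZero x K *
          ((varSum x (insert j N \ K) + ((a + b + 2 : ℤ) : A) * varSum x K) *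
            T g a b (insert j N \ K))
        = (varSum x N + ((a + b + 2 : ℤ) : A) * x j) * T g a b N
          + (varSum x N + ((2 * g + N.card + a + b + 3 : ℤ) : A) * x j) * Q := by
      have h0 : ∑ K ∈ N.powerset, (if K = ∅ then
          (varSum x N + ((a + b + 2 : ℤ) : A) * x j) * T g a b N else 0)
          = (varSum x N + ((a + b + 2 : ℤ) : A) * x j) * T g a b N := by
        simp [sum_ite_eq']
      rw [sum_powerset_insert hj, ← h0, hQ, mul_sum, ← sum_add_distrib, ← sum_add_distrib]
      refine sum_congr rfl fun K hK => ?_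
      have hjK : j ∉ K := fun h => hj (mem_powerset.1 hK h)
      have hjNK : j ∉ N \ K := fun h => hj (sdiff_subset h)
      rw [insert_sdiff_of_notMem _ hjK, insert_sdiff_insert, sdiff_insert_of_notMem hj,
        varSum_insert _ hjNK, varSum_insert _ hjK, genusZero_insert x he K hjK]
      rcases K.eq_empty_or_nonempty with rfl | hne
      · have : varSum x (∅ : Finset ι) = 0 := sum_empty
        rw [genusZero_empty, if_pos rfl, if_pos rfl, sdiff_empty, this]
        ring
      · have hc := card_add_card_sdiff' hK
        have hpos := card_pos.2 hne
        rw [if_neg hne.ne_empty, if_neg hne.ne_empty, ih _ (by omega) g a b _ hjNK rfl,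
          ← varSum_add_sdiff x hK, ← hc]
        push_cast
        linear_combination genusZero x K * T g a b (N \ K) *
          (K.card * (a + b + 2) + 2 * g + (N \ K).card + a + b + 2) * he
    have h1 := hT g a b (insert j N)
    have h2 := hT g a b N
    rw [← hQ] at h2
    rw [hS, varSum_insert _ hj, card_insert_of_notMem hj] at h1
    refine natCast_mul_cancel (k := 12 * (2 * g + N.card + 1)) (by omega) ?_
    rcases Nat.eq_zero_or_pos g with rfl | hg
    · rw [if_pos rfl] at h1 h2
      push_cast at h1 h2 ⊢
      linear_combination h1 - (varSum x N + (N.card + a + b + 3) * x j) * h2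
    · rw [if_neg hg.ne', ih _ (by omega) (g - 1) (a + 1) (b + 1) N hj rfl] at h1
      rw [if_neg hg.ne'] at h2
      push_cast [Nat.cast_pred hg] at h1 h2 ⊢
      linear_combination h1 - (varSum x N + (2 * g + N.card + a + b + 3) * x j) * h2
        - 3 * (2 * g + N.card + a + b + 2) * T (g - 1) (a + 1) (b + 1) N * he

end

section

variable {n : ℕ}

lemma HasTop.coeff_yBracket {j : ℕ} {a b : ℤ} {K N : Finset (Fin n)} {t : ℤ → ℤ → R n}
    (h : ∀ a b : ℤ, HasTop (PowerSeries.coeff j (yPairing n a b N)) (2 * j + a + b) (t a b)) :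
    HasTop (PowerSeries.coeff j (yBracket a b K N)) (2 * j + a + b)
      ((varSum X N + ((a + b + 2 : ℤ) : R n) * varSum X K) * t a b) := by
  have hw1 : ∀ m : ℤ, ∑ L ∈ N.powerset, LExp true (varSum X L) m *
      PowerSeries.coeff j (yPuncture n true L * yWeighted n false b (N \ L))
      = PowerSeries.coeff j (yPairing n m b N) := by
    intro m
    rw [yPairing, SetFun.mul_apply, map_sum]
    refine sum_congr rfl fun L _ => ?_
    rw [yWeighted_apply true, mul_assoc, PowerSeries.coeff_C_mul]
  have hw2 : ∀ m : ℤ, ∑ L ∈ N.powerset, LExp false (varSum X (N \ L)) m *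
      PowerSeries.coeff j (yPuncture n false (N \ L) * yWeighted n true a L)
      = PowerSeries.coeff j (yPairing n a m N) := by
    intro m
    rw [yPairing, SetFun.mul_apply, map_sum]
    refine sum_congr rfl fun L _ => ?_
    rw [yWeighted_apply false, mul_left_comm, PowerSeries.coeff_C_mul, mul_comm (yPuncture _ _ _)]
  obtain ⟨t₁, h₁⟩ := HasTop.sum_shift true N.powerset
    (fun L => PowerSeries.coeff j (yPuncture n true L * yWeighted n false b (N \ L)))
    (fun L => varSum X L) (varSum X K) (2 * j + b) (a + 1)
    (fun m => ⟨t m b, by rw [hw1]; exact (h m b).congr (by ring) rfl⟩)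
  obtain ⟨t₂, h₂⟩ := HasTop.sum_shift false N.powerset
    (fun L => PowerSeries.coeff j (yPuncture n false (N \ L) * yWeighted n true a L))
    (fun L => varSum X (N \ L)) (varSum X K) (2 * j + a) (b + 1)
    (fun m => ⟨t a m, by rw [hw2]; exact (h a m).congr (by ring) rfl⟩)
  have hadd := congrArg (PowerSeries.coeff j) (yPairing_add_one a b N)
  rw [map_add, PowerSeries.coeff_C_mul] at hadd
  rw [hw1, hw1, add_sub_cancel_right] at h₁
  rw [hw2, hw2, add_sub_cancel_right] at h₂
  have hBr : PowerSeries.coeff j (yBracket a b K N)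
      = ∑ L ∈ N.powerset, LExp true (varSum X L + varSum X K) (a + 1) *
          PowerSeries.coeff j (yPuncture n true L * yWeighted n false b (N \ L))
        + ∑ L ∈ N.powerset, LExp false (varSum X (N \ L) + varSum X K) (b + 1) *
          PowerSeries.coeff j (yPuncture n false (N \ L) * yWeighted n true a L) := by
    rw [yBracket, map_sum, ← sum_add_distrib]
    refine sum_congr rfl fun L _ => ?_
    rw [map_add, mul_assoc, mul_assoc, PowerSeries.coeff_C_mul, PowerSeries.coeff_C_mul]
  have hlow := (h₁.of_lt (m' := 2 * j + a + b) (by linarith)).add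
    (h₂.of_lt (m' := 2 * j + a + b) (by linarith))
  have hmain := (HasTop.const_mul (varSum X N + ((a + b + 2 : ℤ) : R n) * varSum X K) (h a b)).add
    hlow
  rw [hBr]
  refine Eq.mp (congrArg₂ (fun f c => HasTop f _ c) ?_ ?_) hmain
  · have e2 : HahnSeries.C (varSum X N + ((a + b + 2 : ℤ) : R n) * varSum X K)
        = (HahnSeries.C (varSum X N) + HahnSeries.C (((a + 1 : ℤ) : R n) * varSum X K)
          + HahnSeries.C (((b + 1 : ℤ) : R n) * varSum X K) : Lau n) := by
      rw [← map_add, ← map_add]; congr 1; push_cast; ring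
    rw [e2]
    linear_combination -hadd
  · ring

/-- The coefficient of `y^(2 g + a + b)` in the genus `g` part of `yPairing n a b`. -/
def topCoeff (g : ℕ) (a b : ℤ) (N : Finset (Fin n)) : R n :=
  (PowerSeries.coeff g (yPairing n a b N)).coeff (-(2 * g + a + b))

lemma coeff_yPairing_eqn (g : ℕ) (a b : ℤ) (N : Finset (Fin n)) :
    ((12 * (2 * g + N.card) : ℕ) : Lau n) * PowerSeries.coeff g (yPairing n a b N)
      = (if g = 0 then 0 else
          HahnSeries.C (varSum X N ^ 3) * PowerSeries.coeff (g - 1) (yPairing n a b N)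
          - HahnSeries.C (3 * varSum X N) *
            PowerSeries.coeff (g - 1) (yPairing n (a + 1) (b + 1) N))
        + HahnSeries.C (12 : R n) * ∑ K ∈ N.powerset, ∑ p ∈ antidiagonal g,
          HahnSeries.C (PowerSeries.coeff p.1 (twoPuncture (X : Fin n → R n) K)) *
            PowerSeries.coeff p.2 (yBracket a b K (N \ K)) := by
  have h := congrArg (PowerSeries.coeff g) (yPairing_eqn a b N)
  rw [map_add, coeff_X_mul_ite, map_sub, PowerSeries.coeff_C_mul, PowerSeries.coeff_C_mul,
    coeff_ofNat_mul, coeff_ofNat_mul, map_add, coeff_genusDer, coeff_natCast_mul, map_sum] at h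
  simp only [PowerSeries.coeff_mul] at h
  rw [map_ofNat]
  push_cast
  rw [mul_assoc, add_mul, h]
  rfl

lemma HasTop.natCast_mul_yPairing {g : ℕ} {N : Finset (Fin n)}
    (h : ∀ (g' : ℕ) (N' : Finset (Fin n)), g' + N'.card < g + N.card → ∀ a b : ℤ,
      HasTop (PowerSeries.coeff g' (yPairing n a b N')) (2 * g' + a + b) (topCoeff g' a b N'))
    (a b : ℤ) :
    HasTop (((12 * (2 * g + N.card) : ℕ) : Lau n) * PowerSeries.coeff g (yPairing n a b N))
      (2 * g + a + b)
      ((if g = 0 then 0 else -(3 * varSum X N * topCoeff (g - 1) (a + 1) (b + 1) N))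
        + 12 * ∑ K ∈ N.powerset, genusZero X K *
          ((varSum X (N \ K) + ((a + b + 2 : ℤ) : R n) * varSum X K) *
            topCoeff g a b (N \ K))) := by
  rw [coeff_yPairing_eqn]
  refine HasTop.add ?_ (HasTop.const_mul _ (HasTop.sum _ fun K hK => ?_))
  · split_ifs with hg
    · exact HasTop.zero _
    · have hg' : ((g - 1 : ℕ) : ℤ) = g - 1 := by have := Nat.pos_of_ne_zero hg; push_cast [this]; rfl
      have h1 := HasTop.const_mul (varSum X N ^ 3) (h (g - 1) N (by omega) a b)
      have h2 := HasTop.const_mul (3 * varSum X N) (h (g - 1) N (by omega) (a + 1) (b + 1))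
      rw [hg'] at h1 h2
      exact ((h1.of_lt (m' := 2 * g + a + b) (by linarith)).sub
        (h2.congr (m' := 2 * g + a + b) (by ring) rfl)).congr rfl (by ring)
  · rcases K.eq_empty_or_nonempty with rfl | hne
    · simp only [genusZero_empty, twoPuncture_empty, map_zero, zero_mul, sum_const_zero]
      exact HasTop.zero _
    have hcard : (N \ K).card + K.card = N.card := by
      rw [add_comm]; exact card_add_card_sdiff' hK
    have hpos := card_pos.2 hne
    have hterm : ∀ p ∈ antidiagonal g, HasTop
        (HahnSeries.C (PowerSeries.coeff p.1 (twoPuncture (X : Fin n → R n) K)) *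
            PowerSeries.coeff p.2 (yBracket a b K (N \ K))) (2 * g + a + b)
        (if p = (0, g) then genusZero X K *
          ((varSum X (N \ K) + ((a + b + 2 : ℤ) : R n) * varSum X K) *
            topCoeff g a b (N \ K)) else 0) := by
      rintro ⟨i, j⟩ hp
      rw [HasAntidiagonal.mem_antidiagonal] at hp
      have h1 := HasTop.const_mul (PowerSeries.coeff i (twoPuncture (X : Fin n → R n) K))
        (HasTop.coeff_yBracket (a := a) (b := b) (K := K) (h j (N \ K) (by dsimp only at hp; omega)))
      split_ifs with hij
      · obtain ⟨rfl, rfl⟩ := Prod.mk.inj hij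
        exact h1
      · refine h1.of_lt ?_
        have : j < g := by
          rcases Nat.eq_zero_or_pos i with rfl | hi
          · exact absurd (by simpa using hp) hij
          · dsimp only at hp; omega
        have : (j : ℤ) < g := by exact_mod_cast this
        linarith
    have := HasTop.sum _ hterm
    rwa [sum_ite_eq', if_pos (by simp)] at this

lemma coeff_zero_yPairing_empty (a b : ℤ) :
    PowerSeries.coeff 0 (yPairing n a b ∅) = LExp true 0 a * LExp false 0 b := by
  have h : ∀ σ, PowerSeries.coeff 0 (yPuncture n σ ∅) = 1 := by
    intro σ
    rw [yPuncture_apply, insertNone_eq, Finset.map_empty, insert_empty_eq,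
      coeff_twoPuncture_zero_single]
  simp only [PowerSeries.coeff_zero_eq_constantCoeff] at h ⊢
  rw [yPairing, SetFun.mul_apply, powerset_empty, sum_singleton, yWeighted_apply, yWeighted_apply,
    sdiff_self, bot_eq_empty, map_mul, map_mul, map_mul, h, h]
  simp [varSum]

lemma hasTop_yPairing (g : ℕ) (N : Finset (Fin n)) (a b : ℤ) :
    HasTop (PowerSeries.coeff g (yPairing n a b N)) (2 * g + a + b) (topCoeff g a b N) := by
  suffices h : ∃ c, HasTop (PowerSeries.coeff g (yPairing n a b N)) (2 * g + a + b) c by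
    obtain ⟨c, hc⟩ := h
    rwa [topCoeff, hc.coeff_eq]
  induction hk : g + N.card using Nat.strong_induction_on generalizing g N a b with
  | _ k ih =>
    rcases Nat.eq_zero_or_pos k with rfl | hpos
    · obtain ⟨rfl, hN⟩ := Nat.add_eq_zero_iff.1 hk
      rw [card_eq_zero.1 hN, coeff_zero_yPairing_empty]
      exact ⟨_, ((hasTop_LExp true 0 a).mul (hasTop_LExp false 0 b)).congr (by simp) rfl⟩
    · refine ⟨_, HasTop.of_natCast_mul (k := 12 * (2 * g + N.card)) (by omega)
        (HasTop.natCast_mul_yPairing (fun g' N' hlt a b => ?_) a b)⟩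
      obtain ⟨c, hc⟩ := ih _ (hk ▸ hlt) g' N' a b rfl
      rwa [topCoeff, hc.coeff_eq]

lemma topCoeff_zero_empty (a b : ℤ) :
    topCoeff 0 a b (∅ : Finset (Fin n)) = if Even b then 1 else -1 := by
  have h := (hasTop_LExp true (0 : R n) a).mul (hasTop_LExp false 0 b)
  rw [← coeff_zero_yPairing_empty] at h
  rw [topCoeff, Nat.cast_zero, mul_zero, zero_add, h.coeff_eq]
  simp

lemma topCoeff_eqn (g : ℕ) (a b : ℤ) (N : Finset (Fin n)) :
    12 * (2 * g + N.card) * topCoeff g a b N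
      = (if g = 0 then 0 else -(3 * varSum X N * topCoeff (g - 1) (a + 1) (b + 1) N))
        + 12 * ∑ K ∈ N.powerset, genusZero X K *
          ((varSum X (N \ K) + ((a + b + 2 : ℤ) : R n) * varSum X K) *
            topCoeff g a b (N \ K)) := by
  have h1 := HasTop.natCast_mul_yPairing (g := g) (N := N)
    (fun g' N' _ a b => hasTop_yPairing g' N' a b) a b
  have h2 := HasTop.const_mul ((12 * (2 * g + N.card) : ℕ) : R n) (hasTop_yPairing g N a b)
  rw [map_natCast] at h2
  rw [← h1.coeff_eq, h2.coeff_eq]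
  push_cast
  rfl

end

section

variable {n : ℕ}

/-- The degree of `f` in the variables indexed by `L` is at most `m`. -/
def PartialDegreeLE (L : Finset (Fin n)) (m : ℕ) (f : R n) : Prop :=
  ∀ d, coeff d f ≠ 0 → ∑ j ∈ L, d j ≤ m

namespace PartialDegreeLE

variable {L : Finset (Fin n)} {m m' : ℕ} {f f' : R n}

lemma coeff_eq_zero (h : PartialDegreeLE L m f) {d : Fin n →₀ ℕ} (hd : m < ∑ j ∈ L, d j) :
    coeff d f = 0 := by
  by_contra hc
  exact absurd (h d hc) (by omega)

lemma mono (h : PartialDegreeLE L m f) (hm : m ≤ m') : PartialDegreeLE L m' f :=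
  fun d hd => (h d hd).trans hm

lemma zero : PartialDegreeLE L m 0 := fun d hd => absurd (coeff_zero d) hd

lemma add (h : PartialDegreeLE L m f) (h' : PartialDegreeLE L m f') :
    PartialDegreeLE L m (f + f') := by
  intro d hd
  rw [coeff_add] at hd
  by_cases hf : coeff d f = 0
  · exact h' d (by rwa [hf, zero_add] at hd)
  · exact h d hf

lemma sum {κ : Type*} {s : Finset κ} {F : κ → R n} (h : ∀ i ∈ s, PartialDegreeLE L m (F i)) :
    PartialDegreeLE L m (∑ i ∈ s, F i) := by
  classical
  induction s using Finset.induction_on with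
  | empty => exact zero
  | insert i s hi ih =>
    rw [sum_insert hi]
    exact (h i (mem_insert_self i s)).add (ih fun k hk => h k (mem_insert_of_mem hk))

lemma mul (h : PartialDegreeLE L m f) (h' : PartialDegreeLE L m' f') :
    PartialDegreeLE L (m + m') (f * f') := by
  intro d hd
  rw [coeff_mul] at hd
  obtain ⟨p, hp, hne⟩ := exists_ne_zero_of_sum_ne_zero hd
  rw [HasAntidiagonal.mem_antidiagonal] at hp
  rw [← hp]
  simp only [Finsupp.add_apply, sum_add_distrib]
  exact add_le_add (h _ (left_ne_zero_of_mul hne)) (h' _ (right_ne_zero_of_mul hne))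

lemma C (r : ℚ) : PartialDegreeLE L m (C r : R n) := by
  intro d hd
  rw [coeff_C] at hd
  have : 0 = d := by by_contra hne; exact hd (if_neg hne)
  simp [← this]

lemma intCast (z : ℤ) : PartialDegreeLE L m (z : R n) := by
  rw [← map_intCast (MvPolynomial.C (σ := Fin n) (R := ℚ))]; exact C _

lemma of_natCast_mul {k : ℕ} (hk : k ≠ 0) (h : PartialDegreeLE L m ((k : R n) * f)) :
    PartialDegreeLE L m f := by
  intro d hd
  refine h d ?_
  rw [← map_natCast (MvPolynomial.C (σ := Fin n) (R := ℚ)), coeff_C_mul]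
  exact mul_ne_zero (by exact_mod_cast hk) hd

lemma varSum (N : Finset (Fin n)) : PartialDegreeLE L 1 (varSum X N : R n) := by
  refine sum fun i _ d hd => ?_
  rw [coeff_X] at hd
  have : Finsupp.single i 1 = d := by by_contra hne; exact hd (if_neg hne)
  subst this
  simp only [Finsupp.single_apply, sum_ite_eq]
  split_ifs <;> simp

lemma varSum_of_disjoint {N : Finset (Fin n)} (hN : Disjoint N L) :
    PartialDegreeLE L 0 (_root_.varSum X N : R n) := by
  refine sum fun i hi d hd => ?_
  rw [coeff_X] at hd
  have : Finsupp.single i 1 = d := by by_contra hne; exact hd (if_neg hne)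
  subst this
  simp only [Finsupp.single_apply, sum_ite_eq, if_neg (disjoint_left.1 hN hi), le_refl]

end PartialDegreeLE

lemma partialDegreeLE_genusZero (L I : Finset (Fin n)) :
    PartialDegreeLE L (I.card - 1) (genusZero X I) ∧
      (Disjoint I L → PartialDegreeLE L 0 (genusZero X I)) := by
  induction hk : I.card using Nat.strong_induction_on generalizing I with
  | _ k ih =>
    rcases Nat.lt_or_ge 1 I.card with h1 | h1
    · have hterm : ∀ J ∈ I.powerset,
          PartialDegreeLE L (I.card - 2) (genusZero (X : Fin n → R n) J * genusZero X (I \ J)) ∧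
          (Disjoint I L →
            PartialDegreeLE L 0 (genusZero (X : Fin n → R n) J * genusZero X (I \ J))) := by
        intro J hJ
        have hc := card_add_card_sdiff' hJ
        rcases J.eq_empty_or_nonempty with rfl | hne
        · rw [genusZero_empty, zero_mul]
          exact ⟨PartialDegreeLE.zero, fun _ => PartialDegreeLE.zero⟩
        rcases (I \ J).eq_empty_or_nonempty with he | hne'
        · rw [he, genusZero_empty, mul_zero]
          exact ⟨PartialDegreeLE.zero, fun _ => PartialDegreeLE.zero⟩
        have := card_pos.2 hne
        have := card_pos.2 hne'
        have h2 := ih J.card (by omega) J rfl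
        have h3 := ih (I \ J).card (by omega) (I \ J) rfl
        exact ⟨(h2.1.mul h3.1).mono (by omega), fun hd =>
          (h2.2 (hd.mono_left (mem_powerset.1 hJ))).mul (h3.2 (hd.mono_left sdiff_subset))⟩
      have hcast : ((2 * (I.card - 1) : ℕ) : R n) * genusZero X I
          = varSum X I * (genusZero X * genusZero X : SetFun (Fin n) (R n)) I := by
        rw [← genusZero_eqn]; push_cast [Nat.cast_pred (zero_lt_one.trans h1)]; rfl
      refine ⟨PartialDegreeLE.of_natCast_mul (k := 2 * (I.card - 1)) (by omega) ?_, fun hd =>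
        PartialDegreeLE.of_natCast_mul (k := 2 * (I.card - 1)) (by omega) ?_⟩
      · rw [hcast, SetFun.mul_apply]
        exact ((PartialDegreeLE.varSum I).mul
          (PartialDegreeLE.sum fun J hJ => (hterm J hJ).1)).mono (by omega)
      · rw [hcast, SetFun.mul_apply]
        exact (PartialDegreeLE.varSum_of_disjoint hd).mul
          (PartialDegreeLE.sum fun J hJ => (hterm J hJ).2 hd)
    · have h01 : ∀ m, PartialDegreeLE L m (genusZero (X : Fin n → R n) I) := by
        intro m
        rcases I.eq_empty_or_nonempty with rfl | hne
        · rw [genusZero_empty]; exact PartialDegreeLE.zero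
        · obtain ⟨i, rfl⟩ := card_eq_one.1 (le_antisymm h1 (card_pos.2 hne))
          rw [genusZero_singleton, ← C_1]
          exact PartialDegreeLE.C 1
      exact ⟨h01 _, fun _ => h01 _⟩

lemma partialDegreeLE_topCoeff (g : ℕ) (a b : ℤ) {L N : Finset (Fin n)} (hd : Disjoint N L) :
    PartialDegreeLE L 0 (topCoeff g a b N) := by
  induction hk : g + N.card using Nat.strong_induction_on generalizing g a b N with
  | _ k ih =>
    rcases Nat.eq_zero_or_pos k with rfl | hpos
    · obtain ⟨rfl, hN⟩ := Nat.add_eq_zero_iff.1 hk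
      rw [card_eq_zero.1 hN, topCoeff_zero_empty]
      split_ifs
      · exact PartialDegreeLE.C 1
      · rw [← C_1, ← C_neg]; exact PartialDegreeLE.C (-1)
    · refine PartialDegreeLE.of_natCast_mul (k := 12 * (2 * g + N.card)) (by omega) ?_
      have h := topCoeff_eqn g a b N
      push_cast
      rw [h]
      have hv := PartialDegreeLE.varSum_of_disjoint hd
      have hC : ∀ r : R n, (∃ z : ℤ, r = z) → PartialDegreeLE L 0 r := by
        rintro _ ⟨z, rfl⟩; exact PartialDegreeLE.intCast z
      refine PartialDegreeLE.add ?_ (PartialDegreeLE.mul (m := 0) (m' := 0)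
        (hC 12 ⟨12, by norm_num⟩) (PartialDegreeLE.sum fun K hK => ?_))
      · split_ifs with hg
        · exact PartialDegreeLE.zero
        · have := ((hC (-3) ⟨-3, by norm_num⟩).mul hv).mul
            (ih _ (by omega) (g - 1) (a + 1) (b + 1) hd rfl)
          rwa [neg_mul, neg_mul] at this
      · rcases K.eq_empty_or_nonempty with rfl | hne
        · rw [genusZero_empty, zero_mul]; exact PartialDegreeLE.zero
        have hc := card_add_card_sdiff' hK
        have := card_pos.2 hne
        have hK' := hd.mono_left (mem_powerset.1 hK)
        have hNK := hd.mono_left (sdiff_subset (s := N) (t := K))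
        exact ((partialDegreeLE_genusZero L K).2 hK').mul
          (((PartialDegreeLE.varSum_of_disjoint hNK).add
            ((PartialDegreeLE.intCast _).mul (PartialDegreeLE.varSum_of_disjoint hK'))).mul
            (ih _ (by omega) g a b hNK rfl))

end

section

variable {n : ℕ}

lemma map_genusZero {A : Type*} [CommRing A] [Algebra ℚ A] (φ : R n →+* A) (I : Finset (Fin n)) :
    φ (genusZero X I) = genusZero (φ ∘ X) I := by
  have h := congrArg (PowerSeries.coeff 0) (map_twoPuncture (X : Fin n → R n) φ I)
  rwa [PowerSeries.coeff_map] at h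

lemma coeff_topCoeff_insert (g : ℕ) (a b : ℤ) {N : Finset (Fin n)} {j : Fin n} (hj : j ∉ N)
    {d : Fin n →₀ ℕ} (hd : d j = 1) :
    coeff d (topCoeff g a b (insert j N))
      = (2 * g + N.card + a + b + 2 : ℤ) *
        coeff (d - Finsupp.single j 1) (topCoeff g a b N) := by
  set φ := Ideal.Quotient.mk (Ideal.span {(X j : R n) ^ 2}) with hφ
  have he : (φ ∘ X) j ^ 2 = 0 := by
    rw [Function.comp_apply, ← map_pow, hφ, Ideal.Quotient.eq_zero_iff_mem]
    exact Ideal.mem_span_singleton_self _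
  have h := insert_of_topCoeff_eqn (φ ∘ X) (T := fun g a b N => φ (topCoeff g a b N)) ?_ he g a b
    N hj
  · have h1 : φ (topCoeff g a b (insert j N))
        = φ ((varSum X N + ((2 * g + N.card + a + b + 2 : ℤ) : R n) * X j) *
          topCoeff g a b N) := by
      rw [h, map_mul, map_add, map_mul, map_varSum, map_intCast]; rfl
    rw [hφ, Ideal.Quotient.eq, Ideal.mem_span_singleton] at h1
    obtain ⟨q, hq⟩ := h1
    have hp : coeff d (varSum X N * topCoeff g a b N) = 0 := by
      have hdis : Disjoint N {j} := disjoint_singleton_right.2 hj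
      refine ((PartialDegreeLE.varSum_of_disjoint hdis).mul
        (partialDegreeLE_topCoeff g a b hdis)).coeff_eq_zero ?_
      simp [hd]
    have hX : ∀ p : R n, coeff d (X j * p) = coeff (d - Finsupp.single j 1) p := by
      intro p
      rw [coeff_X_mul', if_pos (by simp [hd])]
    have hq0 : coeff d (X j ^ 2 * q) = 0 := by
      rw [pow_two, mul_assoc, hX, coeff_X_mul', if_neg (by simp [hd])]
    rw [← hq, coeff_sub, add_mul, coeff_add, hp, zero_add, mul_assoc,
      ← map_intCast (MvPolynomial.C (σ := Fin n) (R := ℚ)), coeff_C_mul, hX] at hq0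
    exact sub_eq_zero.1 hq0
  · intro g a b N
    have h := congrArg φ (topCoeff_eqn g a b N)
    simp only [map_mul, map_add, map_sum, map_natCast, map_ofNat, map_intCast, map_varSum,
      map_genusZero, apply_ite φ, map_neg, map_zero] at h
    exact h

lemma two_mul_card_le {N : Finset (Fin n)} {d : Fin n → ℕ} (h : ∀ j ∈ N, 2 ≤ d j) :
    2 * N.card ≤ ∑ j ∈ N, d j := by
  have h' := card_nsmul_le_sum N d 2 h
  rwa [smul_eq_mul, mul_comm] at h'

lemma coeff_topCoeff_of_two_le (g : ℕ) (a b : ℤ) {N : Finset (Fin n)} {d : Fin n →₀ ℕ}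
    (hd : ∀ j ∈ N, 2 ≤ d j) :
    4 * (2 * g + N.card) * coeff d (topCoeff g a b N)
      = if g = 0 then 0 else
        -∑ j ∈ N, coeff (d - Finsupp.single j 1) (topCoeff (g - 1) (a + 1) (b + 1) N) := by
  have h := congrArg (coeff d) (topCoeff_eqn g a b N)
  have h0 : coeff d (∑ K ∈ N.powerset, genusZero X K *
          ((varSum X (N \ K) + ((a + b + 2 : ℤ) : R n) * varSum X K) *
            topCoeff g a b (N \ K))) = 0 := by
    rw [coeff_sum]
    refine sum_eq_zero fun K hK => ?_
    rcases K.eq_empty_or_nonempty with rfl | hne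
    · rw [genusZero_empty, zero_mul, coeff_zero]
    have := card_pos.2 hne
    have := two_mul_card_le (d := d) fun j hj => hd j (mem_powerset.1 hK hj)
    exact ((partialDegreeLE_genusZero K K).1.mul
      (((PartialDegreeLE.varSum (N \ K)).add
        (((PartialDegreeLE.intCast (m := 0) _).mul (PartialDegreeLE.varSum K)).mono
          (by omega))).mul
        (partialDegreeLE_topCoeff g a b sdiff_disjoint))).coeff_eq_zero (by omega)
  have hX : ∀ p : R n, coeff d (varSum X N * p) = ∑ j ∈ N, coeff (d - Finsupp.single j 1) p := by
    intro p
    rw [varSum, sum_mul, coeff_sum]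
    refine sum_congr rfl fun j hj => ?_
    rw [coeff_X_mul', if_pos]
    have := hd j hj
    simp only [Finsupp.mem_support_iff]
    omega
  have hc1 : (12 * (2 * g + N.card) : R n) = C (12 * (2 * g + N.card) : ℚ) := by
    simp only [map_mul, map_add, map_natCast, map_ofNat]
  have hc2 : (12 : R n) = C (12 : ℚ) := (map_ofNat _ 12).symm
  rw [hc1, coeff_C_mul, coeff_add, hc2, coeff_C_mul, h0, mul_zero, add_zero] at h
  split_ifs at h ⊢ with hg
  · rw [coeff_zero] at h
    linear_combination h / 3
  · have hc3 : (3 : R n) = C (3 : ℚ) := (map_ofNat _ 3).symm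
    rw [coeff_neg, hc3, mul_assoc (C 3), coeff_C_mul, hX] at h
    linear_combination h / 3

lemma doubleFactorial_two_mul_sub_one {k : ℕ} (hk : 2 ≤ k) :
    (Nat.doubleFactorial (2 * k - 1) : ℚ)
      = (2 * k - 1) * Nat.doubleFactorial (2 * (k - 1) - 1) := by
  obtain ⟨l, rfl⟩ := Nat.exists_eq_add_of_le' hk
  have h1 : 2 * (l + 2) - 1 = 2 * l + 1 + 2 := by omega
  have h2 : 2 * (l + 2 - 1) - 1 = 2 * l + 1 := by omega
  rw [h1, h2, Nat.doubleFactorial_add_two]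
  push_cast; ring

lemma prod_doubleFactorial_sub_single {N : Finset (Fin n)} {d : Fin n →₀ ℕ} {j : Fin n}
    (hj : j ∈ N) (hd : 2 ≤ d j) :
    ∏ i ∈ N, (Nat.doubleFactorial (2 * d i - 1) : ℚ)
      = (2 * d j - 1) *
        ∏ i ∈ N, (Nat.doubleFactorial (2 * (d - Finsupp.single j 1 : Fin n →₀ ℕ) i - 1) : ℚ) := by
  rw [← mul_prod_erase N _ hj, ← mul_prod_erase N _ hj, doubleFactorial_two_mul_sub_one hd,
    Finsupp.tsub_apply, Finsupp.single_eq_same, mul_assoc]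
  congr 2
  refine prod_congr rfl fun i hi => ?_
  rw [Finsupp.tsub_apply, Finsupp.single_eq_of_ne (ne_of_mem_erase hi), tsub_zero]

lemma coeff_topCoeff (g : ℕ) (a b : ℤ) {N : Finset (Fin n)} {d : Fin n →₀ ℕ}
    (hd : ∀ j ∈ N, 1 ≤ d j) (hd' : ∀ j ∉ N, d j = 0) (hsum : ∑ j ∈ N, d j = g + N.card) :
    coeff d (topCoeff g a b N)
      = (if Even b then 1 else -1) *
        (∏ i ∈ range N.card, ((2 * g + a + b + 2 + i : ℤ) : ℚ)) /
          (4 ^ g * ∏ j ∈ N, (Nat.doubleFactorial (2 * d j - 1) : ℚ)) := by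
  induction hk : g + N.card using Nat.strong_induction_on generalizing g a b N d with
  | _ k ih =>
    by_cases h1 : ∃ j ∈ N, d j = 1
    · obtain ⟨j, hj, hdj⟩ := h1
      have hjN : j ∉ N.erase j := notMem_erase j N
      have hc : N.card = (N.erase j).card + 1 := (card_erase_add_one hj).symm
      have hdi : ∀ i ∈ N.erase j, (d - Finsupp.single j 1 : Fin n →₀ ℕ) i = d i := fun i hi => by
        rw [Finsupp.tsub_apply, Finsupp.single_eq_of_ne (ne_of_mem_erase hi), tsub_zero]
      have hs : d j + ∑ i ∈ N.erase j, d i = ∑ i ∈ N, d i := add_sum_erase N (fun i => d i) hj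
      conv_lhs => rw [← insert_erase hj]
      rw [coeff_topCoeff_insert g a b hjN hdj, ih (g + (N.erase j).card) (by omega) g a b ?_ ?_ ?_ rfl,
        ← mul_prod_erase N _ hj, hdj, hc, prod_range_succ,
        prod_congr (s₁ := N.erase j) rfl fun i hi => by rw [hdi i hi]]
      · push_cast
        simp only [Nat.doubleFactorial]
        ring
      · intro i hi
        rw [hdi i hi]
        exact hd i (mem_of_mem_erase hi)
      · intro i hi
        rw [Finsupp.tsub_apply]
        by_cases hij : i = j
        · rw [hij, hdj, Finsupp.single_eq_same]
        · rw [hd' i fun h => hi (mem_erase.2 ⟨hij, h⟩), zero_tsub]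
      · refine (sum_congr rfl hdi).trans ?_
        change ∑ i ∈ N.erase j, d i = _
        omega
    · have h2 : ∀ j ∈ N, 2 ≤ d j := fun j hj => by
        have := hd j hj
        have : d j ≠ 1 := fun h => h1 ⟨j, hj, h⟩
        omega
      have hle := two_mul_card_le h2
      rcases Nat.eq_zero_or_pos g with rfl | hg
      · obtain rfl : N = ∅ := card_eq_zero.1 (by omega)
        obtain rfl : d = 0 := by ext i; exact hd' i (notMem_empty i)
        rw [topCoeff_zero_empty]
        split_ifs <;> simp
      · have h := coeff_topCoeff_of_two_le g a b h2
        rw [if_neg hg.ne'] at h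
        set D := ∏ j ∈ N, (Nat.doubleFactorial (2 * d j - 1) : ℚ) with hD
        set Q := (if Even b then 1 else -1) *
          ∏ i ∈ range N.card, ((2 * g + a + b + 2 + i : ℤ) : ℚ) with hQ
        have hD0 : D ≠ 0 := prod_ne_zero_iff.2 fun j _ => by
          exact_mod_cast (Nat.doubleFactorial_pos _).ne'
        have hterm : ∀ j ∈ N, coeff (d - Finsupp.single j 1)
            (topCoeff (g - 1) (a + 1) (b + 1) N)
            = -(4 * Q / (4 ^ g * D)) * (2 * d j - 1) := by
          intro j hj
          have hdj := h2 j hj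
          have hsing : Finsupp.single j 1 ≤ d := Finsupp.single_le_iff.2 (by omega)
          rw [ih (g - 1 + N.card) (by omega) (g - 1) (a + 1) (b + 1) ?_ ?_ ?_ rfl]
          · have hDj := prod_doubleFactorial_sub_single hj hdj
            rw [← hD] at hDj
            have hb : (if Even (b + 1) then (1 : ℚ) else -1) = -(if Even b then 1 else -1) := by
              by_cases hb : Even b <;> simp [hb]
            have hp : ∏ i ∈ range N.card,
                ((2 * (g - 1 : ℕ) + (a + 1) + (b + 1) + 2 + i : ℤ) : ℚ)
                = ∏ i ∈ range N.card, ((2 * g + a + b + 2 + i : ℤ) : ℚ) :=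
              prod_congr rfl fun i _ => by push_cast [Nat.cast_pred hg]; ring
            have h4 : (4 : ℚ) ^ g = 4 * 4 ^ (g - 1) := by
              rw [← pow_succ', Nat.sub_add_cancel hg]
            have hd0 : (2 * d j - 1 : ℚ) ≠ 0 := by
              have : (2 : ℚ) ≤ d j := by exact_mod_cast hdj
              linarith
            rw [hb, hp, neg_mul, ← hQ, h4, hDj]
            have hP : ∏ i ∈ N,
                (Nat.doubleFactorial (2 * (d - Finsupp.single j 1 : Fin n →₀ ℕ) i - 1) : ℚ) ≠ 0 := fun h0 => by
              rw [h0, mul_zero] at hDj; exact hD0 hDj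
            field_simp
          · intro i hi
            have := h2 i hi
            rw [Finsupp.tsub_apply, Finsupp.single_apply]
            split_ifs <;> omega
          · intro i hi
            rw [Finsupp.tsub_apply, hd' i hi, zero_tsub]
          · have : ∑ i ∈ N, (d - Finsupp.single j 1 : Fin n →₀ ℕ) i + ∑ i ∈ N, Finsupp.single j 1 i
                = ∑ i ∈ N, d i := by
              rw [← sum_add_distrib]
              exact sum_congr rfl fun i _ => DFunLike.congr_fun (tsub_add_cancel_of_le hsing) i
            simp only [Finsupp.single_apply, sum_ite_eq, if_pos hj] at this
            omega
        rw [sum_congr rfl hterm, ← mul_sum, sum_sub_distrib, ← mul_sum, ← Nat.cast_sum, hsum] at h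
        simp only [sum_const, nsmul_eq_mul, mul_one] at h
        have hne : (4 * (2 * g + N.card) : ℚ) ≠ 0 := by
          have : (0 : ℚ) < g := by exact_mod_cast hg
          positivity
        refine mul_left_cancel₀ hne ?_
        rw [h]
        push_cast
        ring

end

lemma LL_eq_coeff_yPairing (g n : ℕ) (a b : ℤ) :
    LL g n a b = PowerSeries.coeff g (yPairing n (a - 2) (b - 2) univ) := by
  have hL : ∀ (σ : Bool) (c : R n) (m : ℤ), LExp σ c m = LExp σ c (m - 2) * LExp σ c 2 := by
    intro σ c m
    rw [← LExp_add, sub_add_cancel]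
  rw [LL, sum_comm, yPairing, SetFun.mul_apply, map_sum, powerset_univ]
  refine sum_congr rfl fun I _ => ?_
  rw [yWeighted_apply, yWeighted_apply, PowerSeries.coeff_mul,
    Finset.Nat.sum_antidiagonal_eq_sum_range_succ_mk]
  refine sum_congr rfl fun h _ => ?_
  rw [PowerSeries.coeff_C_mul, PowerSeries.coeff_C_mul, yPuncture_apply, yPuncture_apply,
    ← LExp_two_mul_FExp, ← LExp_two_mul_FExp, ← compl_eq_univ_sdiff, hL true _ a, hL false _ b]
  simp only [varSum]
  ring

/-- For `g ≥ 0`, `n ≥ 1`, `a b : ℤ`, and `d_j ≥ 1` with `Σ d_j = g + n`, the coefficient of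
`y^{2g−4+a+b} Π x_j^{d_j}` in `L_g^{a,b}(y,x_1,…,x_n)` equals
`(−1)^b (2g−3+n+a+b)!/(4^g (2g−3+a+b)! Π (2d_j−1)!!)`, where the quotient of factorials is
read as the product `Π_{i=1}^n (2g−3+a+b+i)`. -/
theorem Lab_top_coeff (g n : ℕ) (hn : 1 ≤ n) (a b : ℤ) (d : Fin n → ℕ)
    (hd : ∀ j, 1 ≤ d j) (hsum : ∑ j, d j = g + n) :
    coeffL (LL g n a b) (2*(g : ℤ) - 4 + a + b) d
      = (-1 : ℚ)^b * (∏ i ∈ Finset.range n, (((2*(g : ℤ) - 3 + a + b + i + 1) : ℤ) : ℚ)) /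
          (4^g * ∏ j, (Nat.doubleFactorial (2*(d j)-1) : ℚ)) := by
  have h := coeff_topCoeff g (a - 2) (b - 2) (N := univ)
    (d := Finsupp.equivFunOnFinite.symm d) (fun j _ => hd j)
    (fun j hj => absurd (mem_univ j) hj) (by simpa using hsum)
  have hdeg : (2 * (g : ℤ) - 4 + a + b) = 2 * g + (a - 2) + (b - 2) := by ring
  have hsign : (-1 : ℚ) ^ b = if Even (b - 2) then 1 else -1 := by
    have h2 : Even (b - 2) ↔ Even b := by simp
    rcases Int.even_or_odd b with hb | hb
    · rw [if_pos (h2.2 hb), hb.neg_one_zpow]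
    · rw [if_neg fun h => Int.not_even_iff_odd.2 hb (h2.1 h), hb.neg_one_zpow]
  rw [coeffL, LL_eq_coeff_yPairing, hdeg]
  refine h.trans ?_
  rw [hsign, card_univ, Fintype.card_fin]
  congr 2
  exact prod_congr rfl fun i _ => by push_cast; ring

end
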